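/- Let d, N ∈ ℕ, p ∈ [1,∞), f ∈ F_PE([0,1]^{d×N}), and r ∈ ℕ with r > N. Then there exist a Transformer block TF: ℝ^{(17d+9)×N} → ℝ^{(17d+9)×N} with hardmax attention having two heads, head size 1, and feed-forward width q = 49d+25, and two token-wise affine maps L₁: ℝ^d → ℝ^{17d+9}, L₂: ℝ^{17d+9} → ℝ^d, together with a constant C > 0 independent of r, such that ‖L₂ ∘ TF^{∘r} ∘ L₁ − f‖_{L^p} ≤ (Nd)^{1/p}·(ω^tok_f(δ√d) + ω^cont_f(δ√(Nd))) + ω_f(δ√(Nd)) + C·N^{2/p}·δ^{d/p}, where δ = ((r−N)/2)^{−1/((N+1)d+1)}. -/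

import Mathlib

open scoped BigOperators
open MeasureTheory Matrix

noncomputable section

/-- ReLU activation. -/
def relu (x : ℝ) : ℝ := max x 0

/-- Parameters of a feed-forward layer `FF(x) = W₂·ReLU(W₁x + b₁) + b₂`
of width `q` on `ℝ^m`. -/
structure FFParams (m q : ℕ) where
  W1 : Matrix (Fin q) (Fin m) ℝ
  W2 : Matrix (Fin m) (Fin q) ℝ
  b1 : Fin q → ℝ
  b2 : Fin m → ℝ

/-- Application of a feed-forward layer. -/
def FFParams.apply {m q : ℕ} (P : FFParams m q) (x : Fin m → ℝ) : Fin m → ℝ :=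
  P.W2.mulVec (fun j => relu (P.W1.mulVec x j + P.b1 j)) + P.b2

/-- Parameters of a self-attention layer with `h` heads and head size `s`
on `ℝ^{m×N}`. -/
structure AttnParams (m s h : ℕ) where
  WO : Fin h → Matrix (Fin m) (Fin s) ℝ
  WV : Fin h → Matrix (Fin s) (Fin m) ℝ
  WK : Fin h → Matrix (Fin s) (Fin m) ℝ
  WQ : Fin h → Matrix (Fin s) (Fin m) ℝ

/-- Apply a column map `σ` (e.g. softmax or hardmax) to each column of a
square matrix. -/
def colwise {N : ℕ} (σ : (Fin N → ℝ) → (Fin N → ℝ))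
    (A : Matrix (Fin N) (Fin N) ℝ) : Matrix (Fin N) (Fin N) ℝ :=
  Matrix.of fun i j => σ (fun k => A k j) i

/-- Self-attention: `Attn(X) = Σᵢ W_O^i W_V^i X σ[(W_K^i X)ᵀ W_Q^i X]`,
with `σ` applied columnwise. -/
def AttnParams.apply {m s h N : ℕ} (P : AttnParams m s h)
    (σ : (Fin N → ℝ) → (Fin N → ℝ)) (X : Matrix (Fin m) (Fin N) ℝ) :
    Matrix (Fin m) (Fin N) ℝ :=
  ∑ i : Fin h, P.WO i * (P.WV i * X) * colwise σ ((P.WK i * X)ᵀ * (P.WQ i * X))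

/-- Parameters of a Transformer block. -/
structure TFParams (m s h q : ℕ) where
  attn : AttnParams m s h
  ff : FFParams m q

/-- Transformer block: `TF(X) = X' + FF(X')` (tokenwise), `X' = X + Attn(X)`. -/
def TFParams.apply {m s h q N : ℕ} (P : TFParams m s h q)
    (σ : (Fin N → ℝ) → (Fin N → ℝ)) (X : Matrix (Fin m) (Fin N) ℝ) :
    Matrix (Fin m) (Fin N) ℝ :=
  let X' := X + P.attn.apply σ X
  X' + Matrix.of fun i j => P.ff.apply (fun k => X' k j) i

/-- Softmax applied to a column. -/
def softmaxCol {N : ℕ} (v : Fin N → ℝ) : Fin N → ℝ :=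
  fun i => Real.exp (v i) / ∑ j, Real.exp (v j)

open Classical in
/-- Hardmax applied to a column: the one-hot indicator of the (least) index
achieving the maximal entry. -/
def hardmaxCol {N : ℕ} (v : Fin N → ℝ) : Fin N → ℝ :=
  fun i => if (∀ j, v j ≤ v i) ∧ (∀ j, v j = v i → i ≤ j) then 1 else 0

/-- Token-wise (column-wise) application of the affine map `x ↦ Ax + b`. -/
def affineCols {m d N : ℕ} (A : Matrix (Fin m) (Fin d) ℝ) (b : Fin m → ℝ)
    (X : Matrix (Fin d) (Fin N) ℝ) : Matrix (Fin m) (Fin N) ℝ :=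
  Matrix.of fun i j => A.mulVec (fun k => X k j) i + b i

/-- The input cube `[0,1]^{d×N}`. -/
def cube (d N : ℕ) : Set (Matrix (Fin d) (Fin N) ℝ) :=
  {X | ∀ i j, X i j ∈ Set.Icc (0 : ℝ) 1}

/-- Entrywise `p`-norm of a matrix. -/
def pNorm {d N : ℕ} (p : ℝ) (X : Matrix (Fin d) (Fin N) ℝ) : ℝ :=
  (∑ i, ∑ j, |X i j| ^ p) ^ (1 / p)

/-- Entrywise `p`-norm of a vector. -/
def vpNorm {d : ℕ} (p : ℝ) (x : Fin d → ℝ) : ℝ :=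
  (∑ i, |x i| ^ p) ^ (1 / p)

/-- Entrywise `2`-norm of a matrix. -/
def twoNorm {d N : ℕ} (X : Matrix (Fin d) (Fin N) ℝ) : ℝ :=
  Real.sqrt (∑ i, ∑ j, X i j ^ 2)

/-- Entrywise `2`-norm of a vector. -/
def vtwoNorm {d : ℕ} (x : Fin d → ℝ) : ℝ :=
  Real.sqrt (∑ i, x i ^ 2)

/-- Modulus of sequence continuity
`ω_f(δ) = sup{‖f(X)−f(X')‖_p : X, X' ∈ [0,1]^{d×N}, ‖X−X'‖₂ ≤ δ}`. -/
def modSeq {d N : ℕ} (p : ℝ)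
    (f : Matrix (Fin d) (Fin N) ℝ → Matrix (Fin d) (Fin N) ℝ) (δ : ℝ) : ℝ :=
  sSup {t | ∃ X ∈ cube d N, ∃ X' ∈ cube d N,
    twoNorm (X - X') ≤ δ ∧ t = pNorm p (f X - f X')}

/-- Modulus of contextual continuity `ω^cont_f`. -/
def modCtx {d N : ℕ} (p : ℝ)
    (f : Matrix (Fin d) (Fin N) ℝ → Matrix (Fin d) (Fin N) ℝ) (δ : ℝ) : ℝ :=
  sSup {t | ∃ n : Fin N, ∃ X ∈ cube d N, ∃ X' ∈ cube d N,
    twoNorm (X - X') ≤ δ ∧ (∀ i, X i n = X' i n) ∧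
    t = vpNorm p (fun i => f X i n - f X' i n)}

/-- Modulus of token continuity `ω^tok_f`. -/
def modTok {d N : ℕ} (p : ℝ)
    (f : Matrix (Fin d) (Fin N) ℝ → Matrix (Fin d) (Fin N) ℝ) (δ : ℝ) : ℝ :=
  sSup {t | ∃ n : Fin N, ∃ X ∈ cube d N, ∃ X' ∈ cube d N,
    vtwoNorm (fun i => X i n - X' i n) ≤ δ ∧
    (∀ q, q ≠ n → ∀ i, X i q = X' i q) ∧
    t = vpNorm p (fun i => f X i n - f X' i n)}

instance matrixMeasureSpace (d N : ℕ) :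
    MeasureSpace (Matrix (Fin d) (Fin N) ℝ) :=
  inferInstanceAs (MeasureSpace (Fin d → Fin N → ℝ))

/-- `L^p` norm of `g` over the cube `[0,1]^{d×N}`:
`(∫_{[0,1]^{d×N}} ‖g(X)‖_p^p dX)^{1/p}`. -/
def LpNormOn {d N : ℕ} (p : ℝ)
    (g : Matrix (Fin d) (Fin N) ℝ → Matrix (Fin d) (Fin N) ℝ) : ℝ :=
  (∫ X in cube d N, pNorm p (g X) ^ p) ^ (1 / p)

/-- Permutation equivariance on the cube: `f(XP) = f(X)P` for every
permutation matrix `P`, expressed via column permutations. -/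
def PermEquivariant {d N : ℕ}
    (f : Matrix (Fin d) (Fin N) ℝ → Matrix (Fin d) (Fin N) ℝ) : Prop :=
  ∀ σ : Equiv.Perm (Fin N), ∀ X ∈ cube d N,
    f (X.submatrix id σ) = (f X).submatrix id σ

/-- The looped network `L₂ ∘ TF^{∘r} ∘ L₁` with token-wise affine maps. -/
def loopedNet {d m N s h q : ℕ} (σ : (Fin N → ℝ) → (Fin N → ℝ))
    (P : TFParams m s h q)
    (A1 : Matrix (Fin m) (Fin d) ℝ) (b1 : Fin m → ℝ)
    (A2 : Matrix (Fin d) (Fin m) ℝ) (b2 : Fin d → ℝ) (r : ℕ)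
    (X : Matrix (Fin d) (Fin N) ℝ) : Matrix (Fin d) (Fin N) ℝ :=
  affineCols A2 b2 ((P.apply σ)^[r] (affineCols A1 b1 X))

end

/-- The discretization width `δ = ((r−N)/2)^{−1/((N+1)d+1)}`. -/
noncomputable def loopDelta (d N r : ℕ) : ℝ :=
  (((r : ℝ) - (N : ℝ)) / 2) ^ (-(1 / (((N : ℝ) + 1) * (d : ℝ) + 1)) : ℝ)

/-- Contracting a coefficient vector extended by zero along an embedding only sees the range. -/
theorem sum_extend_mul {ι κ : Type*} [Fintype ι] [Fintype κ] (e : ι ↪ κ) (g : ι → ℝ)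
    (x : κ → ℝ) :
    ∑ l, Function.extend e g 0 l * x l = ∑ i, g i * x (e i) := by
  symm
  refine Fintype.sum_of_injective e e.injective _ _ ?_ ?_
  · intro l hl
    rw [Function.extend_apply' _ _ _ (by simpa using hl)]
    simp
  · intro i
    rw [e.injective.extend_apply]

/-- A single-head Transformer block of head size one, written over arbitrary finite types of state
coordinates `ι` and hidden units `κ`. -/
structure Block (ι κ : Type) where
  key : ι → ℝ
  query : ι → ℝ
  value : ι → ℝ
  out : ι → ℝ
  inner : κ → ι → ℝ
  bias : κ → ℝ
  outer : κ → ι → ℝ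
  shift : ι → ℝ

namespace Block

variable {ι κ : Type} [Fintype ι] [Fintype κ] {N : ℕ}

/-- The value gathered by the attention head at token `n`. -/
noncomputable def gather (b : Block ι κ) (Y : ι → Fin N → ℝ) (n : Fin N) : ℝ :=
  ∑ k, (∑ l, b.value l * Y l k) *
    hardmaxCol (fun k' => (∑ l, b.key l * Y l k') * ∑ l, b.query l * Y l n) k

/-- The state after the attention layer. -/
noncomputable def mid (b : Block ι κ) (Y : ι → Fin N → ℝ) (i : ι) (n : Fin N) : ℝ :=
  Y i n + b.out i * b.gather Y n

/-- One application of the block. -/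
noncomputable def step (b : Block ι κ) (Y : ι → Fin N → ℝ) (i : ι) (n : Fin N) : ℝ :=
  b.mid Y i n + (∑ u, b.outer u i * relu (∑ l, b.inner u l * b.mid Y l n + b.bias u) + b.shift i)

/-- The block as an honest parameter tuple, padded with zeros. -/
noncomputable def toParams {m q : ℕ} (b : Block ι κ) (e : ι ↪ Fin m) (e' : κ ↪ Fin q) :
    TFParams m 1 2 q where
  attn :=
    { WO := fun h => Matrix.of fun l _ => if h = 0 then Function.extend e b.out 0 l else 0
      WV := fun _ => Matrix.of fun _ l => Function.extend e b.value 0 l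
      WK := fun _ => Matrix.of fun _ l => Function.extend e b.key 0 l
      WQ := fun _ => Matrix.of fun _ l => Function.extend e b.query 0 l }
  ff :=
    { W1 := Matrix.of fun j l => Function.extend e' (fun u => Function.extend e (b.inner u) 0 l) 0 j
      W2 := Matrix.of fun l j => Function.extend e' (fun u => Function.extend e (b.outer u) 0 l) 0 j
      b1 := Function.extend e' b.bias 0
      b2 := Function.extend e b.shift 0 }

theorem toParams_attn_apply {m q : ℕ} (b : Block ι κ) (e : ι ↪ Fin m) (e' : κ ↪ Fin q)
    (X : Matrix (Fin m) (Fin N) ℝ) (i : ι) (n : Fin N) :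
    (b.toParams e e').attn.apply hardmaxCol X (e i) n =
      b.out i * b.gather (fun l k => X (e l) k) n := by
  simp only [AttnParams.apply, toParams, gather, Fin.sum_univ_two, Matrix.add_apply,
    Matrix.mul_apply, colwise, Matrix.of_apply, Matrix.transpose_apply,
    Finset.univ_unique, Finset.sum_singleton, sum_extend_mul, e.injective.extend_apply,
    if_true, one_ne_zero, if_false, zero_mul, Finset.sum_const_zero, add_zero]
  rw [Finset.mul_sum]
  exact Finset.sum_congr rfl fun k _ => mul_assoc _ _ _

theorem toParams_apply {m q : ℕ} (b : Block ι κ) (e : ι ↪ Fin m) (e' : κ ↪ Fin q)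
    (X : Matrix (Fin m) (Fin N) ℝ) (i : ι) (n : Fin N) :
    (b.toParams e e').apply hardmaxCol X (e i) n = b.step (fun l k => X (e l) k) i n := by
  have hmid : ∀ l, (X + (b.toParams e e').attn.apply hardmaxCol X) (e l) n =
      b.mid (fun l k => X (e l) k) l n := fun l => by
    rw [Matrix.add_apply, toParams_attn_apply]; rfl
  simp only [TFParams.apply, Matrix.add_apply (X + _), hmid, Matrix.of_apply, FFParams.apply, step]
  congr 1
  simp only [Pi.add_apply, toParams, Matrix.mulVec, dotProduct, Matrix.of_apply,
    e.injective.extend_apply]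
  rw [sum_extend_mul]
  congr 1
  refine Finset.sum_congr rfl fun u _ => ?_
  simp only [e'.injective.extend_apply]
  rw [sum_extend_mul]
  simp only [← hmid]
  rfl

theorem toParams_iterate {m q : ℕ} (b : Block ι κ) (e : ι ↪ Fin m) (e' : κ ↪ Fin q)
    (t : ℕ) (X : Matrix (Fin m) (Fin N) ℝ) :
    (fun (l : ι) (k : Fin N) => ((b.toParams e e').apply hardmaxCol)^[t] X (e l) k) =
      b.step^[t] (fun l k => X (e l) k) := by
  induction t with
  | zero => rfl
  | succ t ih =>
    rw [Function.iterate_succ_apply', Function.iterate_succ_apply', ← ih]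
    funext l k
    exact toParams_apply b e e' _ l k

end Block

/-- Hardmax attention returns the value at a maximizer of the score. -/
theorem exists_hardmaxCol_sum {N : ℕ} (hN : 0 < N) (v : Fin N → ℝ) :
    ∃ k, (∀ j, v j ≤ v k) ∧ ∀ g : Fin N → ℝ, ∑ k', g k' * hardmaxCol v k' = g k := by
  classical
  have : Nonempty (Fin N) := ⟨⟨0, hN⟩⟩
  obtain ⟨k₀, -, hk₀⟩ := Finset.exists_max_image Finset.univ v Finset.univ_nonempty
  obtain ⟨k, hk, hmin⟩ := Finset.exists_min_image
    (Finset.univ.filter fun k => ∀ j, v j ≤ v k) id ⟨k₀, by simpa using hk₀⟩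
  simp only [Finset.mem_filter, Finset.mem_univ, true_and, id] at hk hmin
  refine ⟨k, hk, fun g => ?_⟩
  rw [Finset.sum_eq_single k]
  · rw [hardmaxCol, if_pos ⟨hk, fun j hj => hmin j fun i => (hk i).trans hj.ge⟩, mul_one]
  · intro k' _ hne
    rw [hardmaxCol, if_neg, mul_zero]
    rintro ⟨h1, h2⟩
    exact hne (le_antisymm (h2 k (le_antisymm (h1 k) (hk k'))) (hmin k' h1))
  · simp

/-- Attending with a positive query to the largest key, with the key as value, gives the
maximum. -/
theorem sum_mul_hardmaxCol_eq {N : ℕ} {μ : Fin N → ℝ} {s M : ℝ} (hs : 0 < s)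
    (hle : ∀ k, μ k ≤ M) (hM : ∃ k, μ k = M) :
    ∑ k, μ k * hardmaxCol (fun k' => μ k' * s) k = M := by
  obtain ⟨k₁, hk₁⟩ := hM
  obtain ⟨k, hk, hsum⟩ := exists_hardmaxCol_sum k₁.pos fun k' => μ k' * s
  rw [hsum μ]
  refine le_antisymm (hle k) ?_
  rw [← hk₁]
  exact le_of_mul_le_mul_right (hk k₁) hs

/-- State coordinates of a token: four vectors (input, quantized input, code word, output) and
four scalars (clock, pending key, received maximum, context code). -/
abbrev Slot (d : ℕ) : Type := (Fin 4 × Fin d) ⊕ Fin 4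

/-- Hidden units: nine per input coordinate and seven shared ones. -/
abbrev Neuron (d : ℕ) : Type := (Fin 9 × Fin d) ⊕ Fin 7

/-- `pulse A y c` equals `y` if the integer `c` is `0`, and `0` at all other integers, as long as
`0 ≤ y ≤ A`. -/
noncomputable def pulse (A y c : ℝ) : ℝ :=
  relu (y - A * c) - relu (-(A * c)) - relu (y - A * (c + 1)) + relu (-(A * (c + 1)))

theorem relu_of_nonneg {x : ℝ} (h : 0 ≤ x) : relu x = x := max_eq_left h

theorem relu_of_nonpos {x : ℝ} (h : x ≤ 0) : relu x = 0 := max_eq_right h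

theorem relu_add_one_sub_relu {x : ℝ} (h : x ≤ -1 ∨ 0 ≤ x) :
    relu (x + 1) - relu x = if 0 ≤ x then 1 else 0 := by
  rcases h with h | h
  · rw [relu_of_nonpos (by linarith), relu_of_nonpos (by linarith), if_neg (by linarith), sub_zero]
  · rw [relu_of_nonneg (by linarith), relu_of_nonneg h, if_pos h]; ring

theorem pulse_intCast {A y : ℝ} (h0 : 0 ≤ y) (hA : y ≤ A) (c : ℤ) :
    pulse A y c = if c = 0 then y else 0 := by
  have hA0 : 0 ≤ A := h0.trans hA
  unfold pulse
  rcases lt_trichotomy c 0 with h | h | h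
  · have hc : (c : ℝ) + 1 ≤ 0 := by exact_mod_cast h
    have h1 : A * (c + 1) ≤ 0 := mul_nonpos_of_nonneg_of_nonpos hA0 hc
    have h2 : A * (c : ℝ) ≤ 0 := mul_nonpos_of_nonneg_of_nonpos hA0 (by linarith)
    rw [relu_of_nonneg (by linarith), relu_of_nonneg (by linarith), relu_of_nonneg (by linarith),
      relu_of_nonneg (by linarith), if_neg h.ne]
    ring
  · subst h
    norm_num
    rw [relu_of_nonneg h0, relu_of_nonpos le_rfl, relu_of_nonpos (by linarith),
      relu_of_nonpos (by linarith)]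
    ring
  · have hc : (1 : ℝ) ≤ c := by exact_mod_cast h
    have h1 : A ≤ A * (c : ℝ) := le_mul_of_one_le_right hA0 hc
    have h2 : A ≤ A * ((c : ℝ) + 1) := le_mul_of_one_le_right hA0 (by linarith)
    rw [relu_of_nonpos (by linarith), relu_of_nonpos (by linarith), relu_of_nonpos (by linarith),
      relu_of_nonpos (by linarith), if_neg h.ne']
    ring

theorem abs_pulse_le {A y : ℝ} (h0 : 0 ≤ y) (c : ℝ) : |pulse A y c| ≤ y := by
  have key : ∀ z : ℝ, 0 ≤ relu (y - z) - relu (-z) ∧ relu (y - z) - relu (-z) ≤ y := by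
    intro z
    unfold relu
    constructor
    · have : max (-z) 0 ≤ max (y - z) 0 := max_le_max (by linarith) le_rfl
      linarith
    · have : max (y - z) 0 ≤ max (-z) 0 + y :=
        max_le (by linarith [le_max_left (-z) 0]) (by linarith [le_max_right (-z) 0])
      linarith
  have h1 := key (A * c)
  have h2 := key (A * (c + 1))
  unfold pulse
  rw [abs_le]
  constructor <;> linarith

/-- The numerical parameters of the looped block. -/
structure Gears (d : ℕ) where
  /-- steepness of the quantizer -/
  slope : ℝ
  /-- number of cells per unit length -/
  cells : ℝ
  /-- modulus of the code words -/
  modulus : ℝ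
  /-- weights of the key loaded once quantization is finished -/
  load : Fin d → ℝ
  loadBias : ℝ
  /-- upper bound of the key -/
  loadMax : ℝ
  /-- clock value at which the key is loaded -/
  loadTime : ℝ
  /-- decay factor of the pending keys -/
  decay : ℝ
  /-- steepness of the masking of the maximal key -/
  mask : ℝ
  /-- weights of the countdown -/
  count : Fin d → ℝ
  countCtx : ℝ
  countBias : ℝ

namespace Gears

variable {d N : ℕ} (g : Gears d)

/-- Linear part of the countdown. -/
noncomputable def countVec : Slot d → ℝ :=
  Sum.elim (fun ji => if ji.1 = 1 then g.count ji.2 else 0) ![-1, 0, 0, g.countCtx]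

/-- Linear part of the loaded key. -/
noncomputable def loadVec : Slot d → ℝ :=
  Sum.elim (fun ji => if ji.1 = 1 then g.load ji.2 else 0) ![0, 0, 0, 0]

/-- Coordinate vector of an entry of the state. -/
noncomputable def unitVec (l : Slot d) : Slot d → ℝ := Pi.single l 1

/-- The looped block. -/
noncomputable def block : Block (Slot d) (Neuron d) where
  key := unitVec (.inr 1)
  query := unitVec (.inr 0)
  value := unitVec (.inr 1)
  out := unitVec (.inr 2)
  inner := Sum.elim
    (fun ji => ![
      (g.slope * g.cells) • unitVec (.inl (0, ji.2)) - g.slope • unitVec (.inr 0),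
      (g.slope * g.cells) • unitVec (.inl (0, ji.2)) - g.slope • unitVec (.inr 0),
      unitVec (.inl (2, ji.2)),
      (2 : ℝ) • unitVec (.inl (2, ji.2)),
      (2 : ℝ) • unitVec (.inl (2, ji.2)),
      unitVec (.inl (2, ji.2)) - g.modulus • g.countVec,
      -(g.modulus • g.countVec),
      unitVec (.inl (2, ji.2)) - g.modulus • g.countVec,
      -(g.modulus • g.countVec)] ji.1)
    ![unitVec (.inr 1),
      (g.decay + g.mask) • unitVec (.inr 1) - g.mask • unitVec (.inr 2),
      g.loadVec - g.loadMax • unitVec (.inr 0),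
      -(g.loadMax • unitVec (.inr 0)),
      g.loadVec - g.loadMax • unitVec (.inr 0),
      -(g.loadMax • unitVec (.inr 0)),
      unitVec (.inr 2)]
  bias := Sum.elim
    (fun ji => ![1, 0, 0, -g.modulus + 1, -g.modulus,
      -(g.modulus * g.countBias), -(g.modulus * g.countBias),
      -(g.modulus * (g.countBias + 1)), -(g.modulus * (g.countBias + 1))] ji.1)
    ![0, 0, g.loadBias + g.loadMax * g.loadTime, g.loadMax * g.loadTime,
      g.loadBias + g.loadMax * (g.loadTime - 1), g.loadMax * (g.loadTime - 1), 0]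
  outer := Sum.elim
    (fun ji => ![
      unitVec (.inl (1, ji.2)),
      -unitVec (.inl (1, ji.2)),
      unitVec (.inl (2, ji.2)),
      -(g.modulus • unitVec (.inl (2, ji.2))),
      g.modulus • unitVec (.inl (2, ji.2)),
      unitVec (.inl (3, ji.2)),
      -unitVec (.inl (3, ji.2)),
      -unitVec (.inl (3, ji.2)),
      unitVec (.inl (3, ji.2))] ji.1)
    ![-((1 - g.decay) • unitVec (.inr 1)),
      -unitVec (.inr 1),
      unitVec (.inr 1),
      -unitVec (.inr 1),
      -unitVec (.inr 1),
      unitVec (.inr 1),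
      unitVec (.inr 3) - unitVec (.inr 2)]
  shift := unitVec (.inr 0)

theorem sum_unitVec_mul (l : Slot d) (y : Slot d → ℝ) : ∑ k, unitVec l k * y k = y l := by
  simp only [unitVec, Pi.single_apply, ite_mul, one_mul, zero_mul, Finset.sum_ite_eq',
    Finset.mem_univ, if_true]

theorem unitVec_dotProduct (l : Slot d) (y : Slot d → ℝ) : unitVec l ⬝ᵥ y = y l :=
  sum_unitVec_mul l y

theorem countVec_dotProduct (y : Slot d → ℝ) :
    g.countVec ⬝ᵥ y =
      ∑ i, g.count i * y (.inl (1, i)) - y (.inr 0) + g.countCtx * y (.inr 3) := by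
  simp [dotProduct, countVec, Fintype.sum_sum_type, Fintype.sum_prod_type, Fin.sum_univ_four]
  ring

theorem loadVec_dotProduct (y : Slot d → ℝ) :
    g.loadVec ⬝ᵥ y = ∑ i, g.load i * y (.inl (1, i)) := by
  simp [dotProduct, loadVec, Fintype.sum_sum_type, Fintype.sum_prod_type, Fin.sum_univ_four]

/-- The maximal pending key, as gathered by the attention head at token `n`. -/
noncomputable def top (Y : Slot d → Fin N → ℝ) (n : Fin N) : ℝ :=
  ∑ k, Y (.inr 1) k * hardmaxCol (fun k' => Y (.inr 1) k' * Y (.inr 0) n) k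

/-- The countdown at token `n`. -/
noncomputable def countdown (Y : Slot d → Fin N → ℝ) (n : Fin N) : ℝ :=
  ∑ i, g.count i * Y (.inl (1, i)) n - Y (.inr 0) n + g.countCtx * Y (.inr 3) n + g.countBias

theorem gather_block (Y : Slot d → Fin N → ℝ) (n : Fin N) : g.block.gather Y n = top Y n := by
  simp only [Block.gather, block, sum_unitVec_mul, top]

theorem mid_block_of_ne (Y : Slot d → Fin N → ℝ) (n : Fin N) {l : Slot d} (hl : l ≠ .inr 2) :
    g.block.mid Y l n = Y l n := by
  simp [Block.mid, block, unitVec, hl]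

theorem mid_block_received (Y : Slot d → Fin N → ℝ) (n : Fin N) :
    g.block.mid Y (.inr 2) n = Y (.inr 2) n + top Y n := by
  rw [Block.mid, gather_block]
  simp [block, unitVec]

/-- The feed-forward part of the block, evaluated on the state `y` of one token. -/
noncomputable def update (y : Slot d → ℝ) (l : Slot d) : ℝ :=
  y l + (∑ u, g.block.outer u l * relu (g.block.inner u ⬝ᵥ y + g.block.bias u)
    + g.block.shift l)

theorem step_block (Y : Slot d → Fin N → ℝ) (l : Slot d) (n : Fin N) :
    g.block.step Y l n = g.update (fun k => g.block.mid Y k n) l := rfl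

theorem update_input (y : Slot d → ℝ) (i : Fin d) :
    g.update y (.inl (0, i)) = y (.inl (0, i)) := by
  simp [update, block, Fintype.sum_sum_type, Fintype.sum_prod_type, Fin.sum_univ_succ, unitVec]


theorem update_quantized (y : Slot d → ℝ) (i : Fin d) :
    g.update y (.inl (1, i)) = y (.inl (1, i)) +
      (relu (g.slope * (g.cells * y (.inl (0, i)) - y (.inr 0)) + 1)
        - relu (g.slope * (g.cells * y (.inl (0, i)) - y (.inr 0)))) := by
  simp [update, block, Fintype.sum_sum_type, Fintype.sum_prod_type, Fin.sum_univ_succ,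
    sub_dotProduct, smul_dotProduct, unitVec_dotProduct]
  simp [unitVec, Pi.single_apply]
  ring_nf

theorem update_codeword (y : Slot d → ℝ) (i : Fin d) :
    g.update y (.inl (2, i)) = y (.inl (2, i)) + relu (y (.inl (2, i))) - g.modulus *
      (relu (2 * y (.inl (2, i)) - g.modulus + 1) - relu (2 * y (.inl (2, i)) - g.modulus)) := by
  simp [update, block, Fintype.sum_sum_type, Fintype.sum_prod_type, Fin.sum_univ_succ,
    sub_dotProduct, smul_dotProduct, unitVec_dotProduct]
  simp [unitVec, Pi.single_apply]
  ring_nf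

theorem update_output (y : Slot d → ℝ) (i : Fin d) :
    g.update y (.inl (3, i)) = y (.inl (3, i)) + pulse g.modulus (y (.inl (2, i)))
      (∑ i, g.count i * y (.inl (1, i)) - y (.inr 0) + g.countCtx * y (.inr 3) + g.countBias) := by
  simp [update, block, Fintype.sum_sum_type, Fintype.sum_prod_type, Fin.sum_univ_succ,
    sub_dotProduct, neg_dotProduct, smul_dotProduct, unitVec_dotProduct, countVec_dotProduct]
  simp [unitVec, Pi.single_apply]
  unfold pulse
  ring_nf

theorem update_clock (y : Slot d → ℝ) : g.update y (.inr 0) = y (.inr 0) + 1 := by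
  simp [update, block, Fintype.sum_sum_type, Fintype.sum_prod_type, Fin.sum_univ_succ, unitVec]

theorem update_key (y : Slot d → ℝ) :
    g.update y (.inr 1) = y (.inr 1) - (1 - g.decay) * relu (y (.inr 1))
      - relu (g.decay * y (.inr 1) - g.mask * (y (.inr 2) - y (.inr 1)))
      + pulse g.loadMax (∑ i, g.load i * y (.inl (1, i)) + g.loadBias)
          (y (.inr 0) - g.loadTime) := by
  simp [update, block, Fintype.sum_sum_type, Fintype.sum_prod_type, Fin.sum_univ_succ,
    sub_dotProduct, neg_dotProduct, smul_dotProduct, unitVec_dotProduct, loadVec_dotProduct]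
  simp [unitVec]
  unfold pulse
  ring_nf

theorem update_received (y : Slot d → ℝ) :
    g.update y (.inr 2) = y (.inr 2) - relu (y (.inr 2)) := by
  simp [update, block, Fintype.sum_sum_type, Fintype.sum_prod_type, Fin.sum_univ_succ,
    unitVec_dotProduct]
  simp [unitVec]
  ring_nf

theorem update_context (y : Slot d → ℝ) :
    g.update y (.inr 3) = y (.inr 3) + relu (y (.inr 2)) := by
  simp [update, block, Fintype.sum_sum_type, Fintype.sum_prod_type, Fin.sum_univ_succ,
    unitVec_dotProduct]
  simp [unitVec]

end Gears

/-- Remove the largest element of a finite set of naturals. -/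
def peel (S : Finset ℕ) : Finset ℕ := S.erase (S.sup id)

theorem peel_subset (S : Finset ℕ) : peel S ⊆ S := Finset.erase_subset _ _

theorem sup_id_mem {S : Finset ℕ} (h : S.Nonempty) : S.sup id ∈ S := by
  obtain ⟨x, hx, hxs⟩ := Finset.exists_mem_eq_sup S h id
  rw [hxs]; exact hx

theorem card_peel_le {S : Finset ℕ} {n : ℕ} (h : S.card ≤ n + 1) : (peel S).card ≤ n := by
  rcases S.eq_empty_or_nonempty with rfl | hS
  · simp [peel]
  · rw [peel, Finset.card_erase_of_mem (sup_id_mem hS)]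
    omega

/-- The base-`B` number whose `n` digits are the elements of `S` in decreasing order. -/
def setCode (B : ℕ) : ℕ → Finset ℕ → ℕ
  | 0, _ => 0
  | n + 1, S => B ^ n * S.sup id + setCode B n (peel S)

theorem setCode_lt {B : ℕ} (n : ℕ) (S : Finset ℕ) (hS : ∀ x ∈ S, x < B) (hB : 0 < B) :
    setCode B n S < B ^ n := by
  induction n generalizing S with
  | zero => simp [setCode]
  | succ n ih =>
    have h1 := ih (peel S) fun x hx => hS x (peel_subset S hx)
    have h2 : S.sup id + 1 ≤ B := (Finset.sup_lt_iff hB).2 hS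
    calc setCode B (n + 1) S < B ^ n * S.sup id + B ^ n := by rw [setCode]; omega
      _ = B ^ n * (S.sup id + 1) := by ring
      _ ≤ B ^ n * B := Nat.mul_le_mul_left _ h2
      _ = B ^ (n + 1) := (pow_succ B n).symm

theorem setCode_injective {B : ℕ} (hB : 0 < B) (n : ℕ) (S S' : Finset ℕ)
    (hS : ∀ x ∈ S, 0 < x ∧ x < B) (hS' : ∀ x ∈ S', 0 < x ∧ x < B)
    (hc : S.card ≤ n) (hc' : S'.card ≤ n) (h : setCode B n S = setCode B n S') : S = S' := by
  induction n generalizing S S' with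
  | zero =>
    rw [Finset.card_eq_zero.1 (Nat.le_zero.1 hc), Finset.card_eq_zero.1 (Nat.le_zero.1 hc')]
  | succ n ih =>
    have hp : ∀ x ∈ peel S, 0 < x ∧ x < B := fun x hx => hS x (peel_subset S hx)
    have hp' : ∀ x ∈ peel S', 0 < x ∧ x < B := fun x hx => hS' x (peel_subset S' hx)
    have h1 := setCode_lt n (peel S) (fun x hx => (hp x hx).2) hB
    have h2 := setCode_lt n (peel S') (fun x hx => (hp' x hx).2) hB
    simp only [setCode] at h
    have hpos : 0 < B ^ n := pow_pos hB n
    have hsup : S.sup id = S'.sup id := by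
      have := congrArg (· / B ^ n) h
      simpa [Nat.mul_add_div hpos, Nat.div_eq_of_lt h1, Nat.div_eq_of_lt h2] using this
    rw [hsup] at h
    have hpeel := ih _ _ hp hp' (card_peel_le hc) (card_peel_le hc') (by omega)
    have hempty : ∀ R : Finset ℕ, (∀ x ∈ R, 0 < x ∧ x < B) → R.sup id = 0 → R = ∅ := by
      intro R hR h0
      by_contra hne
      have := (hR _ (sup_id_mem (Finset.nonempty_iff_ne_empty.2 hne))).1
      omega
    by_cases h0 : S.sup id = 0
    · rw [hempty S hS h0, hempty S' hS' (hsup ▸ h0)]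
    · have hne : ∀ R : Finset ℕ, R.sup id ≠ 0 → R.sup id ∈ R := by
        intro R hR
        refine sup_id_mem (Finset.nonempty_iff_ne_empty.2 ?_)
        rintro rfl
        simp at hR
      rw [← Finset.insert_erase (hne S h0), ← Finset.insert_erase (hne S' (hsup ▸ h0))]
      change insert _ (peel S) = insert _ (peel S')
      rw [hpeel, hsup]

/-- The code of a quantized token: its digits in base `K + 1`, plus one. -/
def tokenCode {d : ℕ} (K : ℕ) (k : Fin d → ℕ) : ℕ :=
  ∑ i : Fin d, (K + 1) ^ (i : ℕ) * k i + 1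

theorem tokenCode_eq {d K : ℕ} (k : Fin d → Fin (K + 1)) :
    tokenCode K (fun i => (k i : ℕ)) = (finFunctionFinEquiv k : ℕ) + 1 := by
  simp [tokenCode, mul_comm]

theorem tokenCode_lt {d K : ℕ} (k : Fin d → ℕ) (hk : ∀ i, k i ≤ K) :
    tokenCode K k < (K + 1) ^ d + 1 := by
  have := tokenCode_eq (K := K) fun i => ⟨k i, Nat.lt_succ_of_le (hk i)⟩
  simp only at this
  rw [this]
  exact Nat.succ_lt_succ (Fin.is_lt _)

theorem tokenCode_pos {d K : ℕ} (k : Fin d → ℕ) : 0 < tokenCode K k := Nat.succ_pos _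

theorem tokenCode_injective {d K : ℕ} (k k' : Fin d → ℕ) (hk : ∀ i, k i ≤ K) (hk' : ∀ i, k' i ≤ K)
    (h : tokenCode K k = tokenCode K k') : k = k' := by
  have h1 := tokenCode_eq (K := K) fun i => ⟨k i, Nat.lt_succ_of_le (hk i)⟩
  have h2 := tokenCode_eq (K := K) fun i => ⟨k' i, Nat.lt_succ_of_le (hk' i)⟩
  simp only at h1 h2
  rw [h1, h2, Nat.add_right_cancel_iff, Fin.val_inj, finFunctionFinEquiv.apply_eq_iff_eq] at h
  funext i
  exact congrArg Fin.val (congrFun h i)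

/-- The index of a token in its context. -/
def tokenIndex {d N : ℕ} (K : ℕ) (k : Fin N → Fin d → ℕ) (n : Fin N) : ℕ :=
  ((K + 1) ^ d + 1) *
    setCode ((K + 1) ^ d + 1) N (Finset.univ.image fun n => tokenCode K (k n)) + tokenCode K (k n)

theorem setCode_tokenCode_lt {d N K : ℕ} (k : Fin N → Fin d → ℕ) (hk : ∀ n i, k n i ≤ K) (m : ℕ) :
    setCode ((K + 1) ^ d + 1) m (Finset.univ.image fun n => tokenCode K (k n)) <
      ((K + 1) ^ d + 1) ^ m := by
  refine setCode_lt _ _ ?_ (Nat.succ_pos _)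
  intro x hx
  obtain ⟨n, -, rfl⟩ := Finset.mem_image.1 hx
  exact tokenCode_lt _ (hk n)

theorem tokenIndex_lt {d N K : ℕ} (k : Fin N → Fin d → ℕ) (hk : ∀ n i, k n i ≤ K) (n : Fin N) :
    tokenIndex K k n < ((K + 1) ^ d + 1) ^ (N + 1) := by
  have h1 := setCode_tokenCode_lt k hk N
  have h2 := tokenCode_lt (k n) (hk n)
  unfold tokenIndex
  generalize setCode _ _ _ = c at *
  generalize (K + 1) ^ d + 1 = B at *
  calc B * c + tokenCode K (k n) < B * c + B := by omega
    _ = B * (c + 1) := by ring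
    _ ≤ B * B ^ N := Nat.mul_le_mul_left _ h1
    _ = B ^ (N + 1) := (pow_succ' B N).symm

/-- Equal indices mean equal contexts up to a permutation matching the two tokens. -/
theorem exists_perm_of_tokenIndex_eq {d N K : ℕ} {k k' : Fin N → Fin d → ℕ}
    (hk : ∀ n i, k n i ≤ K) (hk' : ∀ n i, k' n i ≤ K) (hi : Function.Injective k)
    (hi' : Function.Injective k') {n n' : Fin N} (h : tokenIndex K k n = tokenIndex K k' n') :
    ∃ σ : Equiv.Perm (Fin N), σ n' = n ∧ ∀ j, k' j = k (σ j) := by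
  classical
  have hB : 0 < (K + 1) ^ d + 1 := Nat.succ_pos _
  have h1 := tokenCode_lt (k n) (hk n)
  have h2 := tokenCode_lt (k' n') (hk' n')
  unfold tokenIndex at h
  have hset := congrArg (· / ((K + 1) ^ d + 1)) h
  simp only [Nat.mul_add_div hB, Nat.div_eq_of_lt h1, Nat.div_eq_of_lt h2, add_zero] at hset
  rw [hset] at h
  have htok := tokenCode_injective _ _ (hk n) (hk' n') (Nat.add_left_cancel h)
  have hmem : ∀ (l : Fin N → Fin d → ℕ), (∀ n i, l n i ≤ K) →
      ∀ x ∈ Finset.univ.image fun n => tokenCode K (l n), 0 < x ∧ x < (K + 1) ^ d + 1 := by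
    intro l hl x hx
    obtain ⟨n, -, rfl⟩ := Finset.mem_image.1 hx
    exact ⟨tokenCode_pos _, tokenCode_lt _ (hl n)⟩
  have hcard : ∀ (l : Fin N → Fin d → ℕ),
      (Finset.univ.image fun n => tokenCode K (l n)).card ≤ N := fun l =>
    Finset.card_image_le.trans (by simp)
  have himg := setCode_injective hB N _ _ (hmem k hk) (hmem k' hk') (hcard k) (hcard k') hset
  have hex : ∀ j, ∃ i, k' j = k i := by
    intro j
    have : tokenCode K (k' j) ∈ Finset.univ.image fun n => tokenCode K (k n) := by
      rw [himg]; exact Finset.mem_image_of_mem _ (Finset.mem_univ j)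
    obtain ⟨i, -, hi⟩ := Finset.mem_image.1 this
    exact ⟨i, (tokenCode_injective _ _ (hk i) (hk' j) hi).symm⟩
  choose σ hσ using hex
  have hinj : Function.Injective σ := fun a b hab => hi' (by rw [hσ a, hσ b, hab])
  refine ⟨Equiv.ofBijective σ hinj.bijective_of_finite, ?_, hσ⟩
  exact hi (by rw [Equiv.ofBijective_apply, ← hσ, htok])

/-- A natural number whose base-`2 ^ L` digits are prescribed. -/
theorem exists_digits (L J : ℕ) (w : ℕ → ℕ) (hw : ∀ j, w j < 2 ^ L) :
    ∃ U < 2 ^ (L * J), ∀ j < J,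
      w j * 2 ^ (L * (J - 1)) ≤ 2 ^ (L * j) * U % 2 ^ (L * J) ∧
        2 ^ (L * j) * U % 2 ^ (L * J) < (w j + 1) * 2 ^ (L * (J - 1)) := by
  have key : ∀ J, ∃ U < 2 ^ (L * J), ∀ j < J, ∃ hi lo, lo < 2 ^ (L * (J - 1 - j)) ∧
      U = hi * 2 ^ (L * (J - j)) + w j * 2 ^ (L * (J - 1 - j)) + lo := by
    intro J
    induction J with
    | zero => exact ⟨0, by simp, by simp⟩
    | succ J ih =>
      obtain ⟨U, hU, h⟩ := ih
      refine ⟨U * 2 ^ L + w J, ?_, ?_⟩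
      · calc U * 2 ^ L + w J < (U + 1) * 2 ^ L := by linarith [hw J]
          _ ≤ 2 ^ (L * J) * 2 ^ L := Nat.mul_le_mul_right _ hU
          _ = 2 ^ (L * (J + 1)) := by rw [← pow_add]; ring_nf
      · intro j hj
        rcases Nat.lt_succ_iff_lt_or_eq.1 hj with hj | rfl
        · obtain ⟨hi, lo, hlo, hUe⟩ := h j hj
          refine ⟨hi, lo * 2 ^ L + w J, ?_, ?_⟩
          · calc lo * 2 ^ L + w J < (lo + 1) * 2 ^ L := by linarith [hw J]
              _ ≤ 2 ^ (L * (J - 1 - j)) * 2 ^ L := Nat.mul_le_mul_right _ hlo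
              _ = 2 ^ (L * (J + 1 - 1 - j)) := by
                rw [← pow_add, show J + 1 - 1 - j = J - 1 - j + 1 by omega]; ring_nf
          · rw [hUe, show J + 1 - j = J - j + 1 by omega,
              show J + 1 - 1 - j = J - 1 - j + 1 by omega]
            ring
        · exact ⟨U, 0, by positivity, by simp⟩
  obtain ⟨U, hU, h⟩ := key J
  refine ⟨U, hU, fun j hj => ?_⟩
  obtain ⟨hi, lo, hlo, hUe⟩ := h j hj
  have e1 : 2 ^ (L * j) * 2 ^ (L * (J - j)) = 2 ^ (L * J) := by
    rw [← pow_add, ← mul_add]; congr 2; omega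
  have e2 : 2 ^ (L * j) * 2 ^ (L * (J - 1 - j)) = 2 ^ (L * (J - 1)) := by
    rw [← pow_add, ← mul_add]; congr 2; omega
  have e3 : 2 ^ L * 2 ^ (L * (J - 1)) = 2 ^ (L * J) := by
    rw [← pow_add, show L + L * (J - 1) = L * (J - 1 + 1) by ring]; congr 2; omega
  set R := w j * 2 ^ (L * (J - 1)) + 2 ^ (L * j) * lo with hR
  have hlo' : 2 ^ (L * j) * lo < 2 ^ (L * (J - 1)) := by
    rw [← e2]; exact Nat.mul_lt_mul_of_pos_left hlo (by positivity)
  have hRlt : R < (w j + 1) * 2 ^ (L * (J - 1)) := by rw [hR]; linarith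
  have hmod : 2 ^ (L * j) * U % 2 ^ (L * J) = R := by
    have : 2 ^ (L * j) * U = R + 2 ^ (L * J) * hi := by
      rw [hUe, ← e1, hR, ← e2]; ring
    rw [this, Nat.add_mul_mod_self_left]
    refine Nat.mod_eq_of_lt (hRlt.trans_le ?_)
    rw [← e3]
    exact Nat.mul_le_mul_right _ (hw j)
  rw [hmod]
  exact ⟨Nat.le_add_right _ _, hRlt⟩

/-- One code word serves a whole table of values in `[0, 1)`: shifting it to the `j`-th position
exposes the `j`-th value up to `2⁻ᴸ`. -/
theorem exists_codeword (L J t₀ : ℕ) (v : ℕ → ℝ) (hv : ∀ j, 0 ≤ v j ∧ v j < 1) :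
    ∃ U < 2 ^ (t₀ + L * J), ∀ j < J,
      |((2 ^ (t₀ + L * j) * U % 2 ^ (t₀ + L * J) : ℕ) : ℝ) / 2 ^ (t₀ + L * J) - v j|
        ≤ (1 / 2) ^ L := by
  have hw : ∀ j, ⌊v j * 2 ^ L⌋₊ < 2 ^ L := by
    intro j
    rw [Nat.floor_lt (mul_nonneg (hv j).1 (by positivity))]
    push_cast
    exact mul_lt_of_lt_one_left (by positivity) (hv j).2
  obtain ⟨U, hU, h⟩ := exists_digits L J (fun j => ⌊v j * 2 ^ L⌋₊) hw
  refine ⟨U, hU.trans_le (Nat.pow_le_pow_right two_pos (Nat.le_add_left _ _)), fun j hj => ?_⟩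
  obtain ⟨h1, h2⟩ := h j hj
  rw [pow_add 2 t₀ (L * j), pow_add 2 t₀ (L * J), pow_add (2 : ℝ) t₀ (L * J), mul_assoc,
    Nat.mul_mod_mul_left]
  push_cast
  rw [mul_div_mul_left _ _ (by positivity)]
  have e3 : (2 : ℝ) ^ (L * J) = 2 ^ L * 2 ^ (L * (J - 1)) := by
    rw [← pow_add, show L + L * (J - 1) = L * (J - 1 + 1) by ring]; congr 2; omega
  set R := 2 ^ (L * j) * U % 2 ^ (L * J)
  have h1' : ((⌊v j * 2 ^ L⌋₊ : ℕ) : ℝ) * 2 ^ (L * (J - 1)) ≤ R := by exact_mod_cast h1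
  have h2' : (R : ℝ) ≤ (((⌊v j * 2 ^ L⌋₊ : ℕ) : ℝ) + 1) * 2 ^ (L * (J - 1)) := by
    exact_mod_cast h2.le
  have f1 : ((⌊v j * 2 ^ L⌋₊ : ℕ) : ℝ) ≤ v j * 2 ^ L :=
    Nat.floor_le (mul_nonneg (hv j).1 (by positivity))
  have f2 : v j * 2 ^ L < (⌊v j * 2 ^ L⌋₊ : ℕ) + 1 := Nat.lt_floor_add_one _
  have hP : (0 : ℝ) < 2 ^ (L * (J - 1)) := by positivity
  have hQ : (0 : ℝ) < 2 ^ L := by positivity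
  rw [e3, abs_le, _root_.one_div_pow]
  constructor
  · rw [← sub_nonneg]
    have : (R : ℝ) / (2 ^ L * 2 ^ (L * (J - 1))) ≥ (⌊v j * 2 ^ L⌋₊ : ℕ) / 2 ^ L := by
      rw [ge_iff_le, div_le_div_iff₀ hQ (by positivity)]; nlinarith
    have h3 : v j ≤ ((⌊v j * 2 ^ L⌋₊ : ℕ) + 1) / 2 ^ L := by
      rw [le_div_iff₀ hQ]; exact f2.le
    rw [add_div] at h3
    linarith
  · have : (R : ℝ) / (2 ^ L * 2 ^ (L * (J - 1))) ≤ ((⌊v j * 2 ^ L⌋₊ : ℕ) + 1) / 2 ^ L := by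
      rw [div_le_div_iff₀ (by positivity) hQ]; nlinarith
    have h3 : ((⌊v j * 2 ^ L⌋₊ : ℕ) : ℝ) / 2 ^ L ≤ v j := by
      rw [div_le_iff₀ hQ]; exact f1
    rw [add_div] at this
    linarith

namespace Gears

section StepEquations

variable {d N : ℕ} (g : Gears d) (Y : Slot d → Fin N → ℝ) (n : Fin N)

theorem step_input (i : Fin d) : g.block.step Y (.inl (0, i)) n = Y (.inl (0, i)) n := by
  rw [step_block, update_input, mid_block_of_ne _ _ _ (by simp)]

theorem step_quantized (i : Fin d) :
    g.block.step Y (.inl (1, i)) n = Y (.inl (1, i)) n +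
      (relu (g.slope * (g.cells * Y (.inl (0, i)) n - Y (.inr 0) n) + 1)
        - relu (g.slope * (g.cells * Y (.inl (0, i)) n - Y (.inr 0) n))) := by
  rw [step_block, update_quantized]
  simp only [mid_block_of_ne g Y n (l := .inl _) (by simp),
    mid_block_of_ne g Y n (l := .inr 0) (by simp)]

theorem step_codeword (i : Fin d) :
    g.block.step Y (.inl (2, i)) n =
      Y (.inl (2, i)) n + relu (Y (.inl (2, i)) n) - g.modulus *
        (relu (2 * Y (.inl (2, i)) n - g.modulus + 1)
          - relu (2 * Y (.inl (2, i)) n - g.modulus)) := by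
  rw [step_block, update_codeword]
  simp only [mid_block_of_ne g Y n (l := .inl _) (by simp)]

theorem step_output (i : Fin d) :
    g.block.step Y (.inl (3, i)) n =
      Y (.inl (3, i)) n + pulse g.modulus (Y (.inl (2, i)) n) (g.countdown Y n) := by
  rw [step_block, update_output]
  simp only [mid_block_of_ne g Y n (l := .inl _) (by simp),
    mid_block_of_ne g Y n (l := .inr 0) (by simp), mid_block_of_ne g Y n (l := .inr 3) (by simp)]
  rfl

theorem step_clock : g.block.step Y (.inr 0) n = Y (.inr 0) n + 1 := by
  rw [step_block, update_clock, mid_block_of_ne _ _ _ (by simp)]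

theorem step_key :
    g.block.step Y (.inr 1) n = Y (.inr 1) n - (1 - g.decay) * relu (Y (.inr 1) n)
      - relu (g.decay * Y (.inr 1) n - g.mask * (Y (.inr 2) n + top Y n - Y (.inr 1) n))
      + pulse g.loadMax (∑ i, g.load i * Y (.inl (1, i)) n + g.loadBias)
          (Y (.inr 0) n - g.loadTime) := by
  rw [step_block, update_key]
  simp only [mid_block_of_ne g Y n (l := .inl _) (by simp),
    mid_block_of_ne g Y n (l := .inr 0) (by simp), mid_block_of_ne g Y n (l := .inr 1) (by simp),
    mid_block_received]

theorem step_received :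
    g.block.step Y (.inr 2) n = Y (.inr 2) n + top Y n - relu (Y (.inr 2) n + top Y n) := by
  rw [step_block, update_received, mid_block_received]

theorem step_context :
    g.block.step Y (.inr 3) n = Y (.inr 3) n + relu (Y (.inr 2) n + top Y n) := by
  rw [step_block, update_context, mid_block_received, mid_block_of_ne _ _ _ (by simp)]

end StepEquations

end Gears

/-- The parameters used for `K` cells per side, `L` bits of precision, words of `T` bits and
quantizer steepness `A`. -/
noncomputable def lookupGears (d N K L T : ℕ) (A : ℝ) : Gears d where
  slope := A
  cells := K
  modulus := 2 ^ T
  load i := ((K : ℝ) + 1) ^ (i : ℕ) * ((((K : ℝ) + 1) ^ d + 1) ^ N / (((K : ℝ) + 1) ^ d + 1))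
  loadBias := (((K : ℝ) + 1) ^ d + 1) ^ N / (((K : ℝ) + 1) ^ d + 1)
  loadMax := (((K : ℝ) + 1) ^ d + 1) ^ N
  loadTime := K + 1
  decay := 1 / (((K : ℝ) + 1) ^ d + 1)
  mask := (((K : ℝ) + 1) ^ d + 1) ^ N
  count i := L * ((K : ℝ) + 1) ^ (i : ℕ)
  countCtx := L * (((K : ℝ) + 1) ^ d + 1)
  countBias := L + (K + N + 2)

/-- The initial state. -/
noncomputable def initState {d N : ℕ} (U : Fin d → ℕ) (X : Matrix (Fin d) (Fin N) ℝ) :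
    Slot d → Fin N → ℝ :=
  Sum.elim (fun ji n => ![X ji.2 n, 0, U ji.2, 0] ji.1) (fun j _ => ![1, 0, 0, 0] j)

/-- The state after `t` steps. -/
noncomputable def trajectory {d N : ℕ} (K L T : ℕ) (A : ℝ) (U : Fin d → ℕ)
    (X : Matrix (Fin d) (Fin N) ℝ) (t : ℕ) : Slot d → Fin N → ℝ :=
  (lookupGears d N K L T A).block.step^[t] (initState U X)

section Trajectory

variable {d N : ℕ} (K L T : ℕ) (A : ℝ) (U : Fin d → ℕ) (X : Matrix (Fin d) (Fin N) ℝ)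

theorem trajectory_succ (t : ℕ) :
    trajectory K L T A U X (t + 1) =
      (lookupGears d N K L T A).block.step (trajectory K L T A U X t) :=
  Function.iterate_succ_apply' _ _ _

theorem trajectory_clock (t : ℕ) (n : Fin N) :
    trajectory K L T A U X t (.inr 0) n = t + 1 := by
  induction t with
  | zero => simp [trajectory, initState]
  | succ t ih => rw [trajectory_succ, Gears.step_clock, ih]; push_cast; ring

theorem trajectory_input (t : ℕ) (i : Fin d) (n : Fin N) :
    trajectory K L T A U X t (.inl (0, i)) n = X i n := by
  induction t with
  | zero => simp [trajectory, initState]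
  | succ t ih => rw [trajectory_succ, Gears.step_input, ih]

theorem trajectory_codeword (hU : ∀ i, U i < 2 ^ T) (t : ℕ) (i : Fin d) (n : Fin N) :
    trajectory K L T A U X t (.inl (2, i)) n = (2 ^ t * U i % 2 ^ T : ℕ) := by
  induction t with
  | zero => simp [trajectory, initState, Nat.mod_eq_of_lt (hU i)]
  | succ t ih =>
    rw [trajectory_succ, Gears.step_codeword, ih]
    have hlt : 2 ^ t * U i % 2 ^ T < 2 ^ T := Nat.mod_lt _ (by positivity)
    have hsucc : 2 ^ (t + 1) * U i % 2 ^ T = 2 * (2 ^ t * U i % 2 ^ T) % 2 ^ T := by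
      rw [pow_succ', mul_assoc, Nat.mul_mod_mod]
    rw [hsucc]
    generalize 2 ^ t * U i % 2 ^ T = w at *
    have hH : (lookupGears d N K L T A).modulus = ((2 ^ T : ℕ) : ℝ) := by simp [lookupGears]
    rw [hH]
    generalize 2 ^ T = H at *
    rw [relu_of_nonneg (Nat.cast_nonneg w)]
    rcases lt_or_ge (2 * w) H with h | h
    · have h' : (2 : ℝ) * w + 1 ≤ H := by exact_mod_cast h
      rw [relu_add_one_sub_relu (Or.inl (by linarith)), if_neg (by linarith), Nat.mod_eq_of_lt h]
      push_cast; ring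
    · have h' : (H : ℝ) ≤ 2 * w := by exact_mod_cast h
      rw [relu_add_one_sub_relu (Or.inr (by linarith)), if_pos (by linarith),
        Nat.mod_eq_sub_mod h, Nat.mod_eq_of_lt (by omega)]
      push_cast [h]; ring

theorem abs_trajectory_output_le (hU : ∀ i, U i < 2 ^ T) (t : ℕ) (i : Fin d) (n : Fin N) :
    |trajectory K L T A U X t (.inl (3, i)) n| ≤ t * 2 ^ T := by
  induction t with
  | zero => simp [trajectory, initState]
  | succ t ih =>
    rw [trajectory_succ, Gears.step_output]
    refine (abs_add_le _ _).trans ?_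
    have h1 := trajectory_codeword K L T A U X hU t i n
    have h2 : ((2 ^ t * U i % 2 ^ T : ℕ) : ℝ) ≤ 2 ^ T := by
      exact_mod_cast (Nat.mod_lt (2 ^ t * U i) (by positivity : 0 < 2 ^ T)).le
    rw [h1]
    have h3 := abs_pulse_le (A := (lookupGears d N K L T A).modulus)
      (Nat.cast_nonneg (α := ℝ) (2 ^ t * U i % 2 ^ T))
      ((lookupGears d N K L T A).countdown (trajectory K L T A U X t) n)
    push_cast
    linarith

/-- The grid cell containing each entry of `X`. -/
noncomputable def cellIndex (K : ℕ) (X : Matrix (Fin d) (Fin N) ℝ) (n : Fin N) (i : Fin d) : ℕ :=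
  ⌊(K : ℝ) * X i n⌋₊

/-- No entry of `K * X` lies just below an integer. -/
def Separated (K : ℕ) (A : ℝ) (X : Matrix (Fin d) (Fin N) ℝ) : Prop :=
  ∀ i n, ∀ s ∈ Finset.range (K + 1), A * (K * X i n - s) ≤ -1 ∨ (s : ℝ) ≤ K * X i n

variable {K A X}

theorem cellIndex_le (hX : X ∈ cube d N) (n : Fin N) (i : Fin d) : cellIndex K X n i ≤ K := by
  refine Nat.floor_le_of_le ?_
  exact mul_le_of_le_one_right (Nat.cast_nonneg K) (hX i n).2

theorem trajectory_quantized (hA : 1 ≤ A) (hX : X ∈ cube d N) (hsep : Separated K A X)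
    (t : ℕ) (i : Fin d) (n : Fin N) :
    trajectory K L T A U X t (.inl (1, i)) n = (min t (cellIndex K X n i) : ℕ) := by
  have hx0 : 0 ≤ (K : ℝ) * X i n := mul_nonneg (Nat.cast_nonneg K) (hX i n).1
  induction t with
  | zero => simp [trajectory, initState]
  | succ t ih =>
    rw [trajectory_succ, Gears.step_quantized, ih, trajectory_clock, trajectory_input]
    have hs : A * (K * X i n - ((t + 1 : ℕ) : ℝ)) ≤ -1 ∨ ((t + 1 : ℕ) : ℝ) ≤ K * X i n := by
      by_cases ht : t + 1 ∈ Finset.range (K + 1)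
      · exact hsep i n _ ht
      · left
        have h1 : (K : ℝ) + 1 ≤ ((t + 1 : ℕ) : ℝ) := by
          exact_mod_cast not_lt.1 (mt Finset.mem_range.2 ht)
        have h2 : (K : ℝ) * X i n ≤ K := mul_le_of_le_one_right (Nat.cast_nonneg K) (hX i n).2
        nlinarith
    have hfl : t + 1 ≤ cellIndex K X n i ↔ ((t + 1 : ℕ) : ℝ) ≤ K * X i n := Nat.le_floor_iff hx0
    have hs1 : (lookupGears d N K L T A).slope = A := rfl
    have hs2 : (lookupGears d N K L T A).cells = K := rfl
    rw [hs1, hs2, ← Nat.cast_succ t, Nat.succ_eq_add_one]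
    rcases hs with hs | hs
    · have hneg : ¬ ((t + 1 : ℕ) : ℝ) ≤ K * X i n := by
        intro h
        have : 0 ≤ A * (K * X i n - ((t + 1 : ℕ) : ℝ)) :=
          mul_nonneg (by linarith) (sub_nonneg.2 h)
        linarith
      rw [relu_add_one_sub_relu (Or.inl hs), if_neg (by linarith), add_zero]
      have := mt hfl.1 hneg
      congr 1
      omega
    · have hpos : 0 ≤ A * (K * X i n - ((t + 1 : ℕ) : ℝ)) :=
        mul_nonneg (by linarith) (sub_nonneg.2 hs)
      rw [relu_add_one_sub_relu (Or.inr hpos), if_pos hpos]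
      have := hfl.2 hs
      rw [min_eq_left this, min_eq_left (by omega)]
      push_cast; ring

end Trajectory

theorem setCode_empty (B n : ℕ) : setCode B n ∅ = 0 := by
  induction n with
  | zero => rfl
  | succ n ih => simpa [setCode, peel] using ih

/-- The largest pending key. -/
theorem top_eq {d N : ℕ} {Y : Slot d → Fin N → ℝ} {n : Fin N} {a : Fin N → ℕ} {S : Finset ℕ}
    {ρ : ℝ} (hρ : 0 ≤ ρ) (hS : S ⊆ Finset.univ.image a) (hs : 0 < Y (.inr 0) n)
    (hY : ∀ k, Y (.inr 1) k = ρ * (if a k ∈ S then (a k : ℝ) else 0)) :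
    Gears.top Y n = ρ * (S.sup id : ℕ) := by
  refine sum_mul_hardmaxCol_eq hs (fun k => ?_) ?_
  · rw [hY]
    refine mul_le_mul_of_nonneg_left ?_ hρ
    split_ifs with h
    · exact_mod_cast Finset.le_sup (f := id) h
    · positivity
  · rcases S.eq_empty_or_nonempty with rfl | hne
    · exact ⟨n, by rw [hY]; simp⟩
    · have hmem := sup_id_mem hne
      obtain ⟨k, -, hk⟩ := Finset.mem_image.1 (hS hmem)
      exact ⟨k, by rw [hY, if_pos (hk ▸ hmem), hk]⟩

/-- One masking step: the maximal keys are set to zero, the others decay. -/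
theorem mask_eq {S : Finset ℕ} {a : ℕ} {ρ lam Λ : ℝ} (h0 : 0 ≤ lam) (hρ : S.Nonempty → 1 ≤ ρ)
    (hΛ : lam * (ρ * a) ≤ Λ) (hΛ0 : 0 ≤ Λ) :
    ρ * (if a ∈ S then (a : ℝ) else 0) - (1 - lam) * relu (ρ * (if a ∈ S then (a : ℝ) else 0))
      - relu (lam * (ρ * (if a ∈ S then (a : ℝ) else 0))
        - Λ * (0 + ρ * (S.sup id : ℕ) - ρ * (if a ∈ S then (a : ℝ) else 0)))
      = lam * ρ * (if a ∈ peel S then (a : ℝ) else 0) := by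
  by_cases ha : a ∈ S
  · have hρ1 := hρ ⟨a, ha⟩
    have hm : 0 ≤ ρ * (a : ℝ) := by positivity
    rw [if_pos ha, relu_of_nonneg hm]
    by_cases hmax : a = S.sup id
    · rw [if_neg (by simp [peel, ← hmax]), ← hmax]
      rw [relu_of_nonneg (by nlinarith [mul_nonneg h0 hm])]
      ring
    · rw [if_pos (show a ∈ peel S from Finset.mem_erase.2 ⟨hmax, ha⟩)]
      have hlt : (a : ℝ) + 1 ≤ (S.sup id : ℕ) := by
        have h1 : a ≤ S.sup id := Finset.le_sup (f := id) ha
        exact_mod_cast (by omega : a + 1 ≤ S.sup id)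
      have h1 : 1 ≤ 0 + ρ * (S.sup id : ℕ) - ρ * (a : ℝ) := by nlinarith
      rw [relu_of_nonpos (by nlinarith)]
      ring
  · rw [if_neg ha, if_neg fun h => ha (peel_subset S h)]
    have h1 : 0 ≤ Λ * (ρ * (S.sup id : ℕ)) := by
      rcases S.eq_empty_or_nonempty with rfl | hne
      · simp
      · have := hρ hne; positivity
    rw [mul_zero, relu_of_nonneg le_rfl, relu_of_nonpos (by linarith)]
    ring

section Trajectory

variable {d N K : ℕ} (L T : ℕ) {A : ℝ} (U : Fin d → ℕ) {X : Matrix (Fin d) (Fin N) ℝ}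

/-- The pulse loading the keys. -/
theorem load_pulse (hA : 1 ≤ A) (hX : X ∈ cube d N) (hsep : Separated K A X) (t : ℕ) (n : Fin N) :
    pulse (lookupGears d N K L T A).loadMax
      (∑ i, (lookupGears d N K L T A).load i * trajectory K L T A U X t (.inl (1, i)) n +
        (lookupGears d N K L T A).loadBias)
      (trajectory K L T A U X t (.inr 0) n - (lookupGears d N K L T A).loadTime) =
    if t = K then (((K : ℝ) + 1) ^ d + 1) ^ N / (((K : ℝ) + 1) ^ d + 1)
      * tokenCode K (cellIndex K X n) else 0 := by
  have hY : ∑ i, (lookupGears d N K L T A).load i * trajectory K L T A U X t (.inl (1, i)) n +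
        (lookupGears d N K L T A).loadBias = (((K : ℝ) + 1) ^ d + 1) ^ N / (((K : ℝ) + 1) ^ d + 1)
        * tokenCode K (fun i => min t (cellIndex K X n i)) := by
    simp only [trajectory_quantized L T U hA hX hsep, lookupGears, tokenCode]
    push_cast
    rw [mul_add, mul_one, Finset.mul_sum]
    congr 1
    exact Finset.sum_congr rfl fun i _ => by ring
  have hc : trajectory K L T A U X t (.inr 0) n - (lookupGears d N K L T A).loadTime =
      (((t : ℤ) - K : ℤ) : ℝ) := by
    rw [trajectory_clock]
    simp only [lookupGears]
    push_cast
    ring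
  have hle : (tokenCode K (fun i => min t (cellIndex K X n i)) : ℝ) ≤ ((K : ℝ) + 1) ^ d + 1 := by
    exact_mod_cast (tokenCode_lt _ fun i => (min_le_right _ _).trans (cellIndex_le hX n i)).le
  rw [hY, hc, pulse_intCast (by positivity)]
  · by_cases ht : t = K
    · subst ht
      rw [if_pos (sub_self _), if_pos rfl]
      congr 3
      funext i
      exact min_eq_right (cellIndex_le hX n i)
    · rw [if_neg (by omega), if_neg ht]
  · change _ ≤ (((K : ℝ) + 1) ^ d + 1) ^ N
    rw [div_mul_eq_mul_div, div_le_iff₀ (by positivity)]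
    exact mul_le_mul_of_nonneg_left hle (by positivity)

/-- Before the keys are loaded nothing is exchanged. -/
theorem trajectory_before_load (hA : 1 ≤ A) (hX : X ∈ cube d N) (hsep : Separated K A X) {t : ℕ}
    (ht : t ≤ K) (n : Fin N) :
    trajectory K L T A U X t (.inr 1) n = 0 ∧ trajectory K L T A U X t (.inr 2) n = 0 ∧
      trajectory K L T A U X t (.inr 3) n = 0 := by
  induction t generalizing n with
  | zero => simp [trajectory, initState]
  | succ t ih =>
    have ih' := ih (by omega)
    have htop : Gears.top (trajectory K L T A U X t) n = 0 := by
      simp [Gears.top, (ih' _).1]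
    have hl := load_pulse L T U hA hX hsep t n
    rw [if_neg (by omega)] at hl
    rw [trajectory_succ, Gears.step_key, Gears.step_received, Gears.step_context, hl, htop,
      (ih' n).1, (ih' n).2.1, (ih' n).2.2]
    simp [relu]

/-- After the keys are loaded, they are peeled off one by one and appended to the context code. -/
theorem trajectory_after_load (hA : 1 ≤ A) (hX : X ∈ cube d N) (hsep : Separated K A X)
    (j : ℕ) (n : Fin N) :
    trajectory K L T A U X (K + 1 + j) (.inr 1) n =
        (((K : ℝ) + 1) ^ d + 1) ^ (N - j) / (((K : ℝ) + 1) ^ d + 1) *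
          (if tokenCode K (cellIndex K X n) ∈
              peel^[j] (Finset.univ.image fun n => tokenCode K (cellIndex K X n))
            then (tokenCode K (cellIndex K X n) : ℝ) else 0) ∧
      trajectory K L T A U X (K + 1 + j) (.inr 2) n = 0 ∧
      ∃ c : ℕ, trajectory K L T A U X (K + 1 + j) (.inr 3) n = c ∧
        c + setCode ((K + 1) ^ d + 1) (N - j)
            (peel^[j] (Finset.univ.image fun n => tokenCode K (cellIndex K X n))) =
          setCode ((K + 1) ^ d + 1) N
            (Finset.univ.image fun n => tokenCode K (cellIndex K X n)) := by
  set a : Fin N → ℕ := fun n => tokenCode K (cellIndex K X n) with ha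
  set S₀ := Finset.univ.image a with hS₀
  have hlamdef : (lookupGears d N K L T A).decay = 1 / (((K : ℝ) + 1) ^ d + 1) := rfl
  have hmask : (lookupGears d N K L T A).mask = (((K : ℝ) + 1) ^ d + 1) ^ N := rfl
  have hsub : ∀ j, peel^[j] S₀ ⊆ S₀ := by
    intro j
    induction j with
    | zero => exact subset_rfl
    | succ j ih => rw [Function.iterate_succ_apply']; exact (peel_subset _).trans ih
  have hcard : ∀ j, (peel^[j] S₀).card ≤ N - j := by
    intro j
    induction j with
    | zero => exact Finset.card_image_le.trans (by simp)
    | succ j ih =>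
      rw [Function.iterate_succ_apply']
      by_cases hj : j < N
      · exact card_peel_le (ih.trans (by omega))
      · exact (Finset.card_le_card (peel_subset _)).trans (ih.trans (by omega))
  induction j generalizing n with
  | zero =>
    have ih := trajectory_before_load L T U hA hX hsep le_rfl
    have htop : Gears.top (trajectory K L T A U X K) n = 0 := by
      simp [Gears.top, (ih _).1]
    have hl := load_pulse L T U hA hX hsep K n
    rw [if_pos rfl] at hl
    rw [add_zero, trajectory_succ, Gears.step_key, Gears.step_received, Gears.step_context, hl,
      htop, (ih n).1, (ih n).2.1, (ih n).2.2]
    refine ⟨?_, by simp [relu], 0, by simp [relu], by simp⟩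
    simp [relu, ha, hS₀]
  | succ j ih =>
    set S := peel^[j] S₀ with hS
    set ρ : ℝ := (((K : ℝ) + 1) ^ d + 1) ^ (N - j) / (((K : ℝ) + 1) ^ d + 1) with hρdef
    have hB1 : (1 : ℝ) ≤ ((K : ℝ) + 1) ^ d + 1 := le_add_of_nonneg_left (by positivity)
    have hNj : S.Nonempty → N - j = N - (j + 1) + 1 := by
      intro h
      have h1 : S.card ≤ N - j := hcard j
      have h2 := Finset.card_pos.2 h
      omega
    have hρ' : S.Nonempty → ρ = (((K : ℝ) + 1) ^ d + 1) ^ (N - (j + 1)) := by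
      intro h
      rw [hρdef, hNj h, pow_succ, mul_div_cancel_right₀ _ (by positivity)]
    have hρ1 : S.Nonempty → 1 ≤ ρ := fun h => by rw [hρ' h]; exact one_le_pow₀ hB1
    have htop : Gears.top (trajectory K L T A U X (K + 1 + j)) n = ρ * (S.sup id : ℕ) :=
      top_eq (by positivity) (hsub j) (by rw [trajectory_clock]; positivity) fun k => (ih k).1
    have hl := load_pulse L T U hA hX hsep (K + 1 + j) n
    rw [if_neg (by omega)] at hl
    obtain ⟨h1, h2, c, h3, h4⟩ := ih n
    have haB : (a n : ℝ) ≤ ((K : ℝ) + 1) ^ d + 1 := by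
      exact_mod_cast (tokenCode_lt _ fun i => cellIndex_le hX n i).le
    have hΛ : 1 / (((K : ℝ) + 1) ^ d + 1) * (ρ * a n) ≤ (((K : ℝ) + 1) ^ d + 1) ^ N := by
      have e1 : ρ * a n ≤ (((K : ℝ) + 1) ^ d + 1) ^ (N - j) := by
        rw [hρdef, div_mul_eq_mul_div, div_le_iff₀ (by positivity)]
        exact mul_le_mul_of_nonneg_left haB (by positivity)
      have e2 : (((K : ℝ) + 1) ^ d + 1) ^ (N - j) ≤ (((K : ℝ) + 1) ^ d + 1) ^ N :=
        pow_le_pow_right₀ hB1 (Nat.sub_le _ _)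
      have e3 : 1 / (((K : ℝ) + 1) ^ d + 1) ≤ 1 := by
        rw [div_le_one (by positivity)]; exact hB1
      have e4 : 0 ≤ ρ * a n := by positivity
      nlinarith
    rw [← add_assoc, trajectory_succ, Gears.step_key, Gears.step_received, Gears.step_context, hl,
      htop, h1, h2, h3, hlamdef, hmask, Function.iterate_succ_apply', ← hS]
    have htop0 : 0 ≤ 0 + ρ * (S.sup id : ℕ) := by positivity
    refine ⟨?_, ?_, c + ((K + 1) ^ d + 1) ^ (N - (j + 1)) * S.sup id, ?_, ?_⟩
    · rw [add_zero, mask_eq (by positivity) hρ1 hΛ (by positivity)]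
      rcases S.eq_empty_or_nonempty with he | hne
      · simp [he, peel]
      · rw [hρdef, hNj hne, pow_succ]
        field_simp
        rfl
    · rw [relu_of_nonneg htop0, sub_self]
    · rw [relu_of_nonneg htop0]
      rcases S.eq_empty_or_nonempty with he | hne
      · simp [he]
      · rw [hρ' hne]; push_cast; ring
    · rw [← h4]
      rcases S.eq_empty_or_nonempty with he | hne
      · simp [he, peel, setCode_empty]
      · rw [hNj hne, setCode]; ring

/-- The context code is complete after `K + 1 + N` steps. -/
theorem trajectory_context_eq (hA : 1 ≤ A) (hX : X ∈ cube d N) (hsep : Separated K A X)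
    {t : ℕ} (ht : K + 1 + N ≤ t) (n : Fin N) :
    trajectory K L T A U X t (.inr 3) n =
      (setCode ((K + 1) ^ d + 1) N (Finset.univ.image fun n => tokenCode K (cellIndex K X n)) :
        ℕ) := by
  obtain ⟨j, rfl⟩ := Nat.exists_eq_add_of_le (by omega : K + 1 ≤ t)
  obtain ⟨-, -, c, h3, h4⟩ := trajectory_after_load L T U hA hX hsep j n
  rw [show N - j = 0 by omega, setCode, add_zero] at h4
  rw [h3, h4]

theorem exists_trajectory_context (hA : 1 ≤ A) (hX : X ∈ cube d N) (hsep : Separated K A X)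
    (t : ℕ) (n : Fin N) : ∃ c : ℕ, trajectory K L T A U X t (.inr 3) n = c := by
  by_cases h : t ≤ K
  · exact ⟨0, by rw [(trajectory_before_load L T U hA hX hsep h n).2.2, Nat.cast_zero]⟩
  · obtain ⟨j, rfl⟩ := Nat.exists_eq_add_of_le (by omega : K + 1 ≤ t)
    obtain ⟨-, -, c, h3, -⟩ := trajectory_after_load L T U hA hX hsep j n
    exact ⟨c, h3⟩

/-- The countdown is an integer that vanishes exactly when the code word is in position. -/
theorem exists_countdown_eq (hA : 1 ≤ A) (hX : X ∈ cube d N) (hsep : Separated K A X)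
    (t : ℕ) (n : Fin N) :
    ∃ z : ℤ, (lookupGears d N K L T A).countdown (trajectory K L T A U X t) n = z ∧
      (z = 0 ↔ t = K + 1 + N + L * tokenIndex K (cellIndex K X) n) := by
  obtain ⟨c, hc⟩ := exists_trajectory_context L T U hA hX hsep t n
  have hcd : (lookupGears d N K L T A).countdown (trajectory K L T A U X t) n =
      (((L * (((K + 1) ^ d + 1) * c + tokenCode K fun i => min t (cellIndex K X n i)) : ℕ) : ℤ)
        + (K + 1 + N) - t : ℤ) := by
    rw [Gears.countdown, hc, trajectory_clock]
    simp only [trajectory_quantized L T U hA hX hsep, lookupGears, tokenCode]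
    push_cast
    have hsum : ∑ x : Fin d, (L : ℝ) * ((K : ℝ) + 1) ^ (x : ℕ) * min (t : ℝ) (cellIndex K X n x) =
        L * ∑ x : Fin d, ((K : ℝ) + 1) ^ (x : ℕ) * min (t : ℝ) (cellIndex K X n x) := by
      rw [Finset.mul_sum]
      exact Finset.sum_congr rfl fun i _ => mul_assoc _ _ _
    rw [hsum]
    ring
  refine ⟨_, hcd, ?_⟩
  by_cases ht : K + 1 + N ≤ t
  · have hctx := trajectory_context_eq L T U hA hX hsep ht n
    rw [hc, Nat.cast_inj] at hctx
    have hmin : (fun i => min t (cellIndex K X n i)) = cellIndex K X n :=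
      funext fun i => min_eq_right ((cellIndex_le hX n i).trans (by omega))
    rw [hmin, hctx, ← tokenIndex]
    omega
  · generalize L * (_ + _) = z
    generalize L * tokenIndex _ _ _ = z'
    omega

/-- The output register holds the code word shifted to the position given by the index. -/
theorem trajectory_output (hU : ∀ i, U i < 2 ^ T) (hA : 1 ≤ A) (hX : X ∈ cube d N)
    (hsep : Separated K A X) {t : ℕ} (n : Fin N)
    (ht : K + 1 + N + L * tokenIndex K (cellIndex K X) n < t) (i : Fin d) :
    trajectory K L T A U X t (.inl (3, i)) n =
      (2 ^ (K + 1 + N + L * tokenIndex K (cellIndex K X) n) * U i % 2 ^ T : ℕ) := by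
  set τ := K + 1 + N + L * tokenIndex K (cellIndex K X) n with hτ
  have key : ∀ t, trajectory K L T A U X t (.inl (3, i)) n =
      if τ < t then ((2 ^ τ * U i % 2 ^ T : ℕ) : ℝ) else 0 := by
    intro t
    induction t with
    | zero => simp [trajectory, initState]
    | succ t ih =>
      obtain ⟨z, hz, hz0⟩ := exists_countdown_eq L T U hA hX hsep t n
      rw [← hτ] at hz0
      rw [trajectory_succ, Gears.step_output, ih, hz, trajectory_codeword K L T A U X hU,
        pulse_intCast (Nat.cast_nonneg _)]
      · rcases lt_trichotomy τ t with h | h | h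
        · rw [if_pos h, if_neg (by rw [hz0]; omega), if_pos (by omega), add_zero]
        · rw [if_neg (by omega), if_pos (by rw [hz0]; omega), if_pos (by omega), h, zero_add]
        · rw [if_neg (by omega), if_neg (by rw [hz0]; omega), if_neg (by omega), add_zero]
      · simp only [lookupGears]
        exact_mod_cast (Nat.mod_lt _ (by positivity : 0 < 2 ^ T)).le
  rw [key, if_pos ht]

end Trajectory

/-- The looped network reads off an affine image of the output register. -/
theorem exists_loopedNet_eq {d N : ℕ} (K L T : ℕ) (A : ℝ) (U : Fin d → ℕ) (c M : ℝ) :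
    ∃ (P : TFParams (17 * d + 9) 1 2 (49 * d + 25))
      (A1 : Matrix (Fin (17 * d + 9)) (Fin d) ℝ) (b1 : Fin (17 * d + 9) → ℝ)
      (A2 : Matrix (Fin d) (Fin (17 * d + 9)) ℝ) (b2 : Fin d → ℝ),
      ∀ (r : ℕ) (X : Matrix (Fin d) (Fin N) ℝ) (i : Fin d) (n : Fin N),
        loopedNet hardmaxCol P A1 b1 A2 b2 r X i n =
          c * trajectory K L T A U X r (.inl (3, i)) n - M := by
  obtain ⟨e⟩ : Nonempty (Slot d ↪ Fin (17 * d + 9)) :=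
    Function.Embedding.nonempty_of_card_le (by simp; omega)
  obtain ⟨e'⟩ : Nonempty (Neuron d ↪ Fin (49 * d + 25)) :=
    Function.Embedding.nonempty_of_card_le (by simp; omega)
  refine ⟨(lookupGears d N K L T A).block.toParams e e',
    Matrix.of fun l i => Function.extend e (Pi.single (.inl (0, i)) 1) 0 l,
    Function.extend e
      (Sum.elim (fun ji => ![0, 0, (U ji.2 : ℝ), 0] ji.1) fun j => ![1, 0, 0, 0] j) 0,
    Matrix.of fun i l => Function.extend e (Pi.single (.inl (3, i)) c) 0 l,
    fun _ => -M, fun r X i n => ?_⟩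
  have hstart : (fun (l : Slot d) (k : Fin N) => affineCols
      (Matrix.of fun l i => Function.extend e (Pi.single (.inl (0, i)) 1) 0 l)
      (Function.extend e
        (Sum.elim (fun ji => ![0, 0, (U ji.2 : ℝ), 0] ji.1) fun j => ![1, 0, 0, 0] j) 0)
      X (e l) k) =
      initState U X := by
    funext l k
    simp only [affineCols, Matrix.mulVec, dotProduct, Matrix.of_apply, e.injective.extend_apply]
    rcases l with ⟨j, i⟩ | j
    · have hsingle : ∀ i', (Pi.single (.inl (0, i')) 1 : Slot d → ℝ) (.inl (j, i)) =
          if i' = i then (if j = 0 then 1 else 0) else 0 := by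
        intro i'
        rw [Pi.single_apply]
        by_cases h : i' = i <;> by_cases h' : j = 0 <;> simp [h, h', Ne.symm]
      simp only [hsingle, ite_mul, zero_mul, Finset.sum_ite_eq', Finset.mem_univ, if_true,
        initState, Sum.elim_inl]
      fin_cases j <;> simp
    · simp [initState]
  have hit := congrFun (congrFun (Block.toParams_iterate (lookupGears d N K L T A).block e e' r
    (affineCols (Matrix.of fun l i => Function.extend e (Pi.single (.inl (0, i)) 1) 0 l)
      (Function.extend e
        (Sum.elim (fun ji => ![0, 0, (U ji.2 : ℝ), 0] ji.1) fun j => ![1, 0, 0, 0] j) 0) X))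
    (.inl (3, i))) n
  rw [hstart] at hit
  rw [trajectory, ← hit, loopedNet]
  simp only [affineCols, Matrix.mulVec, dotProduct, Matrix.of_apply]
  rw [sum_extend_mul e, Finset.sum_eq_single (Sum.inl (3, i))]
  · rw [Pi.single_eq_same, sub_eq_add_neg]
  · intro l _ hl
    rw [Pi.single_eq_of_ne hl, zero_mul]
  · simp

/-- The grid point with cell indices `k`. -/
noncomputable def gridPoint {d N : ℕ} (K : ℕ) (k : Fin N → Fin d → ℕ) : Matrix (Fin d) (Fin N) ℝ :=
  Matrix.of fun i n => (k n i : ℝ) / K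

theorem gridPoint_mem_cube {d N K : ℕ} {k : Fin N → Fin d → ℕ} (hk : ∀ n i, k n i ≤ K) :
    gridPoint K k ∈ cube d N := fun i n =>
  ⟨by simp only [gridPoint, Matrix.of_apply]; positivity,
    div_le_one_of_le₀ (by exact_mod_cast hk n i) (Nat.cast_nonneg K)⟩

/-- A permutation equivariant function is determined on grid points with distinct tokens by the
token index. -/
theorem exists_table {d N : ℕ} (K : ℕ) {f : Matrix (Fin d) (Fin N) ℝ → Matrix (Fin d) (Fin N) ℝ}
    (hpe : PermEquivariant f) {M : ℝ} (hM : ∀ X ∈ cube d N, ∀ i n, |f X i n| ≤ M) (hM0 : 0 ≤ M) :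
    ∃ F : ℕ → Fin d → ℝ, (∀ j i, |F j i| ≤ M) ∧
      ∀ k : Fin N → Fin d → ℕ, (∀ n i, k n i ≤ K) → Function.Injective k → ∀ n i,
        F (tokenIndex K k n) i = f (gridPoint K k) i n := by
  have key : ∀ j : ℕ, ∃ v : Fin d → ℝ, (∀ i, |v i| ≤ M) ∧
      ∀ k : Fin N → Fin d → ℕ, (∀ n i, k n i ≤ K) → Function.Injective k → ∀ n,
        tokenIndex K k n = j → ∀ i, v i = f (gridPoint K k) i n := by
    intro j
    by_cases h : ∃ k : Fin N → Fin d → ℕ, (∀ n i, k n i ≤ K) ∧ Function.Injective k ∧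
        ∃ n, tokenIndex K k n = j
    · obtain ⟨k, hk, hinj, n, rfl⟩ := h
      refine ⟨fun i => f (gridPoint K k) i n, fun i => hM _ (gridPoint_mem_cube hk) i n, ?_⟩
      intro k' hk' hinj' n' hn' i
      obtain ⟨σ, hσ, hkσ⟩ := exists_perm_of_tokenIndex_eq hk hk' hinj hinj' hn'.symm
      have hgrid : gridPoint K k' = (gridPoint K k).submatrix id σ := by
        ext i j
        simp [gridPoint, hkσ]
      rw [hgrid, hpe σ _ (gridPoint_mem_cube hk), Matrix.submatrix_apply, hσ, id]
    · refine ⟨0, by simpa using fun _ => hM0, fun k hk hinj n hn => ?_⟩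
      exact absurd ⟨k, hk, hinj, n, hn⟩ h
  choose F hF hF' using key
  exact ⟨F, hF, fun k hk hinj n i => hF' _ k hk hinj n rfl i⟩

/-- The looped network interpolates a permutation equivariant function on the grid. -/
theorem exists_loopedNet_approx {d N K L r : ℕ} {A M : ℝ} (hA : 1 ≤ A)
    {f : Matrix (Fin d) (Fin N) ℝ → Matrix (Fin d) (Fin N) ℝ}
    (hpe : PermEquivariant f) (hM : ∀ X ∈ cube d N, ∀ i n, |f X i n| ≤ M) (hM0 : 0 ≤ M)
    (hr : K + 1 + N + L * ((K + 1) ^ d + 1) ^ (N + 1) < r) :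
    ∃ (P : TFParams (17 * d + 9) 1 2 (49 * d + 25))
      (A1 : Matrix (Fin (17 * d + 9)) (Fin d) ℝ) (b1 : Fin (17 * d + 9) → ℝ)
      (A2 : Matrix (Fin d) (Fin (17 * d + 9)) ℝ) (b2 : Fin d → ℝ),
      ∀ X ∈ cube d N, ∀ i n,
        |loopedNet hardmaxCol P A1 b1 A2 b2 r X i n| ≤ (2 * M + 1) * r + M ∧
        (Separated K A X → |loopedNet hardmaxCol P A1 b1 A2 b2 r X i n| ≤ 3 * M + 1) ∧
        (Separated K A X → Function.Injective (cellIndex K X) →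
          |loopedNet hardmaxCol P A1 b1 A2 b2 r X i n - f (gridPoint K (cellIndex K X)) i n| ≤
            (2 * M + 1) * (1 / 2) ^ L) := by
  obtain ⟨F, hFM, hF⟩ := exists_table K hpe hM hM0
  set J := ((K + 1) ^ d + 1) ^ (N + 1) with hJ
  set T := K + 1 + N + L * J with hT
  have hM1 : 0 < 2 * M + 1 := by linarith
  have hcode : ∀ i, ∃ U < 2 ^ T, ∀ j < J,
      |((2 ^ (K + 1 + N + L * j) * U % 2 ^ T : ℕ) : ℝ) / 2 ^ T - (F j i + M) / (2 * M + 1)|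
        ≤ (1 / 2) ^ L := fun i => by
    refine exists_codeword L J (K + 1 + N) (fun j => (F j i + M) / (2 * M + 1)) fun j => ?_
    have := abs_le.1 (hFM j i)
    exact ⟨div_nonneg (by linarith) hM1.le, (div_lt_one hM1).2 (by linarith)⟩
  choose U hU hUF using hcode
  obtain ⟨P, A1, b1, A2, b2, h⟩ := exists_loopedNet_eq (N := N) K L T A U ((2 * M + 1) / 2 ^ T) M
  have hpow : (0 : ℝ) < 2 ^ T := by positivity
  refine ⟨P, A1, b1, A2, b2, fun X hX i n => ?_⟩
  have hlt := tokenIndex_lt (cellIndex K X) (fun n i => cellIndex_le hX n i) n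
  have hout : Separated K A X → loopedNet hardmaxCol P A1 b1 A2 b2 r X i n =
      (2 * M + 1) * (((2 ^ (K + 1 + N + L * tokenIndex K (cellIndex K X) n) * U i % 2 ^ T : ℕ) : ℝ)
        / 2 ^ T) - M := fun hsep => by
    rw [h, trajectory_output L T U hU hA hX hsep n
      (lt_of_le_of_lt (Nat.add_le_add_left (Nat.mul_le_mul_left L hlt.le) _) hr) i]
    ring
  refine ⟨?_, fun hsep => ?_, fun hsep hinj => ?_⟩
  · have h1 := abs_trajectory_output_le K L T A U X hU r i n
    rw [h]
    refine (abs_sub _ _).trans ?_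
    rw [abs_mul, abs_of_nonneg hM0, abs_of_pos (by positivity)]
    refine add_le_add_left ?_ M
    rw [div_mul_eq_mul_div, div_le_iff₀ hpow, mul_assoc]
    gcongr
  · rw [hout hsep]
    have h1 : ((2 ^ (K + 1 + N + L * tokenIndex K (cellIndex K X) n) * U i % 2 ^ T : ℕ) : ℝ) / 2 ^ T
        ≤ 1 := by
      rw [div_le_one hpow]
      exact_mod_cast (Nat.mod_lt _ (by positivity : 0 < 2 ^ T)).le
    refine (abs_sub _ _).trans ?_
    rw [abs_mul, abs_of_nonneg hM0, abs_of_pos hM1, abs_of_nonneg (by positivity)]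
    nlinarith
  · rw [hout hsep, ← hF _ (fun n i => cellIndex_le hX n i) hinj]
    have h1 := hUF i _ hlt
    refine le_trans (le_of_eq ?_) (mul_le_mul_of_nonneg_left h1 hM1.le)
    rw [← abs_of_pos hM1, ← abs_mul, abs_of_pos hM1]
    congr 1
    field_simp
    ring

/-- The `L^p` norm of a function dominated by a constant outside of two small sets. -/
theorem rpow_integral_rpow_le {α : Type*} [MeasurableSpace α] {μ : Measure α}
    [IsProbabilityMeasure μ] {p : ℝ} (hp : 1 ≤ p) {u : α → ℝ} (hu : ∀ x, 0 ≤ u x)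
    {a c₁ c₂ : ℝ} (ha : 0 ≤ a) (hc₁ : 0 ≤ c₁) (hc₂ : 0 ≤ c₂) {E₁ E₂ : Set α}
    (h : ∀ᵐ x ∂μ, u x ≤ a + E₁.indicator (fun _ => c₁) x + E₂.indicator (fun _ => c₂) x) :
    (∫ x, u x ^ p ∂μ) ^ (1 / p) ≤
      a + c₁ * μ.real E₁ ^ (1 / p) + c₂ * μ.real E₂ ^ (1 / p) := by
  have hp0 : 0 < p := by linarith
  set q := ENNReal.ofReal p with hq
  have hq0 : q ≠ 0 := by simpa [hq] using hp0
  have hqt : q ≠ ⊤ := ENNReal.ofReal_ne_top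
  have hq1 : 1 ≤ q := by simpa [hq] using hp
  have hqr : q.toReal = p := ENNReal.toReal_ofReal hp0.le
  set g₀ : α → ℝ := fun _ => a with hg₀
  set g₁ := (toMeasurable μ E₁).indicator (fun _ => c₁) with hg₁
  set g₂ := (toMeasurable μ E₂).indicator (fun _ => c₂) with hg₂
  have hm₀ : MemLp g₀ q μ := memLp_const a
  have hm₁ : MemLp g₁ q μ :=
    memLp_indicator_const q (measurableSet_toMeasurable _ _) c₁ (Or.inr (measure_ne_top _ _))
  have hm₂ : MemLp g₂ q μ :=
    memLp_indicator_const q (measurableSet_toMeasurable _ _) c₂ (Or.inr (measure_ne_top _ _))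
  have hm := (hm₀.add hm₁).add hm₂
  have hle₁ : ∀ x, E₁.indicator (fun _ => c₁) x ≤ g₁ x := fun x =>
    Set.indicator_le_indicator_of_subset (subset_toMeasurable _ _) (fun _ => hc₁) x
  have hle₂ : ∀ x, E₂.indicator (fun _ => c₂) x ≤ g₂ x := fun x =>
    Set.indicator_le_indicator_of_subset (subset_toMeasurable _ _) (fun _ => hc₂) x
  have hdom : ∀ᵐ x ∂μ, u x ≤ ‖(g₀ + g₁ + g₂) x‖ := by
    filter_upwards [h] with x hx
    refine hx.trans (le_trans ?_ (le_abs_self _))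
    simp only [Pi.add_apply]
    linarith [hle₁ x, hle₂ x]
  have hind : ∀ (E : Set α) {c : ℝ}, 0 ≤ c →
      (eLpNorm ((toMeasurable μ E).indicator (fun _ => c)) q μ).toReal =
        c * μ.real E ^ (1 / p) := by
    intro E c hc
    rw [eLpNorm_indicator_const (measurableSet_toMeasurable _ _) hq0 hqt, measure_toMeasurable,
      ENNReal.toReal_mul, toReal_enorm, Real.norm_of_nonneg hc, ← ENNReal.toReal_rpow, hqr]
    rfl
  calc (∫ x, u x ^ p ∂μ) ^ (1 / p)
      ≤ (∫ x, ‖(g₀ + g₁ + g₂) x‖ ^ p ∂μ) ^ (1 / p) := by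
        refine Real.rpow_le_rpow (integral_nonneg fun x => Real.rpow_nonneg (hu x) _) ?_
          (by positivity)
        refine integral_mono_of_nonneg (ae_of_all _ fun x => Real.rpow_nonneg (hu x) _) ?_ ?_
        · simpa [hqr] using hm.integrable_norm_rpow hq0 hqt
        · filter_upwards [hdom] with x hx
          exact Real.rpow_le_rpow (hu x) hx hp0.le
    _ = lpNorm (g₀ + g₁ + g₂) q μ := by
        rw [lpNorm_eq_integral_norm_rpow_toReal hq0 hqt hm.1, hqr, one_div]
    _ ≤ lpNorm g₀ q μ + lpNorm g₁ q μ + lpNorm g₂ q μ :=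
        (lpNorm_add_le (hm₀.add hm₁) hq1).trans (add_le_add_left (lpNorm_add_le hm₀ hq1) _)
    _ = a + c₁ * μ.real E₁ ^ (1 / p) + c₂ * μ.real E₂ ^ (1 / p) := by
        rw [← toReal_eLpNorm hm₁.1, ← toReal_eLpNorm hm₂.1, hind E₁ hc₁, hind E₂ hc₂, hg₀,
          lpNorm_const hq0 (IsProbabilityMeasure.ne_zero μ)]
        simp [abs_of_nonneg ha]

theorem cube_eq_pi (d N : ℕ) :
    cube d N =
      Set.univ.pi fun _ : Fin d => Set.univ.pi fun _ : Fin N => Set.Icc (0 : ℝ) 1 :=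
  Set.ext fun _ => ⟨fun h i _ n _ => h i n, fun h i n => h i trivial n trivial⟩

/-- The uniform distribution on the cube is a product measure. -/
theorem volume_restrict_cube (d N : ℕ) :
    (volume : Measure (Matrix (Fin d) (Fin N) ℝ)).restrict (cube d N) =
      Measure.pi fun _ : Fin d => Measure.pi fun _ : Fin N =>
        (volume : Measure ℝ).restrict (Set.Icc 0 1) := by
  rw [cube_eq_pi]
  change (Measure.pi fun _ : Fin d =>
    Measure.pi fun _ : Fin N => (volume : Measure ℝ)).restrict _ = _
  rw [Measure.restrict_pi_pi]
  congr 1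
  funext i
  rw [Measure.restrict_pi_pi]

theorem measurableSet_cube (d N : ℕ) : MeasurableSet (cube d N) := by
  rw [cube_eq_pi]
  exact MeasurableSet.univ_pi fun _ => MeasurableSet.univ_pi fun _ => measurableSet_Icc

instance isProbabilityMeasure_restrict_Icc :
    IsProbabilityMeasure ((volume : Measure ℝ).restrict (Set.Icc 0 1)) := ⟨by simp⟩

theorem isProbabilityMeasure_restrict_cube (d N : ℕ) :
    IsProbabilityMeasure ((volume : Measure (Matrix (Fin d) (Fin N) ℝ)).restrict (cube d N)) := by
  rw [volume_restrict_cube]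
  change IsProbabilityMeasure (Measure.pi fun _ : Fin d => Measure.pi fun _ : Fin N =>
        (volume : Measure ℝ).restrict (Set.Icc 0 1))
  infer_instance

/-- The probability that one entry falls into a given set. -/
theorem volume_restrict_cube_entry {d N : ℕ} (i : Fin d) (n : Fin N) {B : Set ℝ}
    (hB : MeasurableSet B) :
    (volume : Measure (Matrix (Fin d) (Fin N) ℝ)).restrict (cube d N) {X | X i n ∈ B} ≤
      volume B := by
  rw [volume_restrict_cube]
  have h1 := measurePreserving_eval (fun _ : Fin d => Measure.pi fun _ : Fin N =>
        (volume : Measure ℝ).restrict (Set.Icc 0 1)) i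
  have h2 := measurePreserving_eval (fun _ : Fin N =>
        (volume : Measure ℝ).restrict (Set.Icc 0 1)) n
  have h3 := (h2.comp h1).measure_preimage hB.nullMeasurableSet
  exact h3.le.trans (Measure.restrict_apply_le _ _)

/-- Two tokens share a cell with small probability. -/
theorem pi_floor_eq_le {N K : ℕ} (hK : 0 < K) {n n' : Fin N} (hn : n ≠ n') :
    (Measure.pi fun _ : Fin N => (volume : Measure ℝ).restrict (Set.Icc 0 1))
      {v | ⌊(K : ℝ) * v n⌋₊ = ⌊(K : ℝ) * v n'⌋₊} ≤ ENNReal.ofReal (1 / K) := by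
  set ν := (volume : Measure ℝ).restrict (Set.Icc 0 1) with hν
  set B : ℕ → Set ℝ := fun s => {x | ⌊(K : ℝ) * x⌋₊ = s} with hB
  have hBm : ∀ s, MeasurableSet (B s) := fun s =>
    (Nat.measurable_floor.comp (measurable_const.mul measurable_id)) (measurableSet_singleton s)
  have hK' : (0 : ℝ) < K := by exact_mod_cast hK
  have hBν : ∀ s, ν (B s) ≤ ENNReal.ofReal (1 / K) := by
    intro s
    rw [hν, Measure.restrict_apply (hBm s)]
    have hsub : B s ∩ Set.Icc 0 1 ⊆ Set.Icc (s / K : ℝ) ((s + 1) / K) := by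
      rintro x ⟨hx, hx0, -⟩
      have hx' : ⌊(K : ℝ) * x⌋₊ = s := hx
      rw [Nat.floor_eq_iff (by positivity)] at hx'
      refine ⟨?_, ?_⟩
      · rw [div_le_iff₀ hK']; linarith
      · rw [le_div_iff₀ hK']; linarith
    refine (measure_mono hsub).trans ?_
    rw [Real.volume_Icc]
    apply ENNReal.ofReal_le_ofReal
    apply le_of_eq
    ring
  have hsum : ∑' s, ν (B s) = 1 := by
    rw [← measure_iUnion _ hBm, ← measure_univ (μ := ν)]
    · congr 1
      ext x
      simp [hB]
    · intro s s' hs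
      exact Set.disjoint_left.2 fun x hx hx' => hs (hx.symm.trans hx')
  have hcover : {v : Fin N → ℝ | ⌊(K : ℝ) * v n⌋₊ = ⌊(K : ℝ) * v n'⌋₊} ⊆
      ⋃ s, Set.univ.pi fun m => if m = n ∨ m = n' then B s else Set.univ := by
    intro v hv
    refine Set.mem_iUnion.2 ⟨⌊(K : ℝ) * v n⌋₊, fun m _ => ?_⟩
    beta_reduce
    by_cases hm : m = n ∨ m = n'
    · rw [if_pos hm]
      rcases hm with rfl | rfl
      · rfl
      · exact hv.symm
    · rw [if_neg hm]; trivial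
  have hbox : ∀ s, Measure.pi (fun _ : Fin N => ν)
      (Set.univ.pi fun m => if m = n ∨ m = n' then B s else Set.univ) = ν (B s) * ν (B s) := by
    intro s
    rw [Measure.pi_pi, ← Finset.prod_subset (Finset.subset_univ {n, n'})]
    · rw [Finset.prod_pair hn]; simp
    · intro m _ hm
      simp only [Finset.mem_insert, Finset.mem_singleton] at hm
      rw [if_neg hm, measure_univ]
  calc _ ≤ ∑' s, ν (B s) * ν (B s) := by
        refine (measure_mono hcover).trans ((measure_iUnion_le _).trans ?_)
        exact ENNReal.tsum_le_tsum fun s => (hbox s).le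
    _ ≤ ∑' s, ENNReal.ofReal (1 / K) * ν (B s) :=
        ENNReal.tsum_le_tsum fun s => by gcongr; exact hBν s
    _ = ENNReal.ofReal (1 / K) := by rw [ENNReal.tsum_mul_left, hsum, mul_one]

/-- Coinciding cell indices are unlikely. -/
theorem volume_cellIndex_not_injective_le {d N K : ℕ} (hK : 0 < K) :
    ((volume : Measure (Matrix (Fin d) (Fin N) ℝ)).restrict (cube d N)).real
      {X | ¬ Function.Injective (cellIndex K X)} ≤ (N : ℝ) ^ 2 * (1 / K) ^ d := by
  set μ := (volume : Measure (Matrix (Fin d) (Fin N) ℝ)).restrict (cube d N) with hμ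
  have hpair : ∀ q ∈ (Finset.univ.filter fun q : Fin N × Fin N => q.1 ≠ q.2),
      μ {X | cellIndex K X q.1 = cellIndex K X q.2} ≤ ENNReal.ofReal ((1 / K) ^ d) := by
    rintro ⟨n, n'⟩ hq
    rw [hμ, volume_restrict_cube]
    have hset : {X : Matrix (Fin d) (Fin N) ℝ | cellIndex K X n = cellIndex K X n'} =
        (Set.univ.pi fun _ : Fin d => {v : Fin N → ℝ | ⌊(K : ℝ) * v n⌋₊ = ⌊(K : ℝ) * v n'⌋₊} :
          Set (Fin d → Fin N → ℝ)) :=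
      Set.ext fun X => ⟨fun h i _ => congrFun h i, fun h => funext fun i => h i trivial⟩
    rw [hset]
    change (Measure.pi fun _ : Fin d => Measure.pi fun _ : Fin N =>
        (volume : Measure ℝ).restrict (Set.Icc 0 1))
        (Set.univ.pi fun _ : Fin d => {v : Fin N → ℝ | ⌊(K : ℝ) * v n⌋₊ = ⌊(K : ℝ) * v n'⌋₊}) ≤ _
    rw [Measure.pi_pi, ENNReal.ofReal_pow (by positivity)]
    refine (Finset.prod_le_prod' fun i _ => pi_floor_eq_le hK (by simpa using hq)).trans ?_
    simp
  have hcover : {X | ¬ Function.Injective (cellIndex K X)} ⊆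
      ⋃ q ∈ (Finset.univ.filter fun q : Fin N × Fin N => q.1 ≠ q.2),
        {X : Matrix (Fin d) (Fin N) ℝ | cellIndex K X q.1 = cellIndex K X q.2} := by
    intro X hX
    simp only [Set.mem_ofPred_eq, Function.Injective, not_forall] at hX
    obtain ⟨n, n', h, hne⟩ := hX
    simp only [Set.mem_iUnion]
    exact ⟨(n, n'), by simpa using hne, h⟩
  refine ENNReal.toReal_le_of_le_ofReal (by positivity) ?_
  calc _ ≤ ∑ q ∈ (Finset.univ.filter fun q : Fin N × Fin N => q.1 ≠ q.2),
        μ {X | cellIndex K X q.1 = cellIndex K X q.2} :=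
        (measure_mono hcover).trans (measure_biUnion_finset_le _ _)
    _ ≤ ∑ q ∈ (Finset.univ.filter fun q : Fin N × Fin N => q.1 ≠ q.2),
        ENNReal.ofReal ((1 / K) ^ d) := Finset.sum_le_sum hpair
    _ ≤ ∑ q : Fin N × Fin N, ENNReal.ofReal ((1 / K) ^ d) :=
        Finset.sum_le_sum_of_subset (Finset.filter_subset _ _)
    _ = ENNReal.ofReal ((N : ℝ) ^ 2 * (1 / K) ^ d) := by
        rw [Finset.sum_const, Finset.card_univ, Fintype.card_prod, Fintype.card_fin, nsmul_eq_mul,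
          ENNReal.ofReal_mul (by positivity), sq]
        congr 1
        rw [← Nat.cast_mul, ENNReal.ofReal_natCast]

/-- A steep quantizer rarely fails. -/
theorem volume_not_separated_le {d N K : ℕ} {A : ℝ} (hK : 0 < K) (hA : 0 < A) :
    ((volume : Measure (Matrix (Fin d) (Fin N) ℝ)).restrict (cube d N)).real
      {X | ¬ Separated K A X} ≤ d * N * (K + 1) / A := by
  set μ := (volume : Measure (Matrix (Fin d) (Fin N) ℝ)).restrict (cube d N) with hμ
  have hK' : (1 : ℝ) ≤ K := by exact_mod_cast hK
  have hone : ∀ (i : Fin d) (n : Fin N) (s : Fin (K + 1)),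
      μ {X | X i n ∈ Set.Icc ((s : ℝ) / K - 1 / A) (s / K)} ≤ ENNReal.ofReal (1 / A) := by
    intro i n s
    refine (volume_restrict_cube_entry i n measurableSet_Icc).trans ?_
    rw [Real.volume_Icc, sub_sub_cancel]
  have hcover : {X | ¬ Separated K A X} ⊆ ⋃ i : Fin d, ⋃ n : Fin N, ⋃ s : Fin (K + 1),
      {X : Matrix (Fin d) (Fin N) ℝ | X i n ∈ Set.Icc ((s : ℝ) / K - 1 / A) (s / K)} := by
    intro X hX
    simp only [Set.mem_ofPred_eq, Separated, not_forall, not_or, not_le] at hX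
    obtain ⟨i, n, s, hs, h1, h2⟩ := hX
    simp only [Set.mem_iUnion]
    refine ⟨i, n, ⟨s, Finset.mem_range.1 hs⟩, ?_, ?_⟩
    · have h3 : -(1 / A) ≤ K * X i n - s := by
        rw [← neg_div, div_le_iff₀ hA]; linarith
      have h4 : -(1 / A) ≤ -(1 / A) / K := by
        rw [le_div_iff₀ (by linarith)]
        have : 0 < 1 / A := by positivity
        nlinarith
      have h5 : -(1 / A) / K ≤ (K * X i n - s) / K := by gcongr
      have h6 : (K * X i n - s) / K = X i n - s / K := by field_simp
      linarith
    · rw [le_div_iff₀ (by linarith)]; linarith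
  refine ENNReal.toReal_le_of_le_ofReal (by positivity) ?_
  calc _ ≤ ∑ i : Fin d, ∑ n : Fin N, ∑ s : Fin (K + 1),
        μ {X | X i n ∈ Set.Icc ((s : ℝ) / K - 1 / A) (s / K)} := by
        refine (measure_mono hcover).trans ((measure_iUnion_fintype_le _ _).trans ?_)
        refine Finset.sum_le_sum fun i _ => (measure_iUnion_fintype_le _ _).trans ?_
        exact Finset.sum_le_sum fun n _ => measure_iUnion_fintype_le _ _
    _ ≤ ∑ i : Fin d, ∑ n : Fin N, ∑ s : Fin (K + 1), ENNReal.ofReal (1 / A) := by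
        gcongr; exact hone _ _ _
    _ = ENNReal.ofReal (d * N * (K + 1) / A) := by
        simp only [Finset.sum_const, Finset.card_univ, Fintype.card_fin, nsmul_eq_mul]
        rw [← mul_assoc, ← mul_assoc, div_eq_mul_one_div (d * N * ((K : ℝ) + 1)) A,
          ENNReal.ofReal_mul (by positivity)]
        congr 1
        rw [← ENNReal.ofReal_natCast, ← ENNReal.ofReal_natCast, ← ENNReal.ofReal_natCast,
          ← ENNReal.ofReal_mul (by positivity), ← ENNReal.ofReal_mul (by positivity)]
        push_cast
        rfl

section Norms

variable {d N : ℕ} {p : ℝ}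

theorem pNorm_nonneg (X : Matrix (Fin d) (Fin N) ℝ) : 0 ≤ pNorm p X :=
  Real.rpow_nonneg (Finset.sum_nonneg fun _ _ => Finset.sum_nonneg fun _ _ =>
    Real.rpow_nonneg (abs_nonneg _) _) _

theorem pNorm_add_le (hp : 1 ≤ p) (X Y : Matrix (Fin d) (Fin N) ℝ) :
    pNorm p (X + Y) ≤ pNorm p X + pNorm p Y := by
  have h := Real.Lp_add_le Finset.univ (fun q : Fin d × Fin N => X q.1 q.2) (fun q => Y q.1 q.2) hp
  simpa only [Fintype.sum_prod_type, pNorm, Matrix.add_apply] using h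

theorem pNorm_le_of_abs_le (hp : 0 < p) {X : Matrix (Fin d) (Fin N) ℝ} {c : ℝ} (hc : 0 ≤ c)
    (h : ∀ i n, |X i n| ≤ c) : pNorm p X ≤ ((N : ℝ) * d) ^ (1 / p) * c := by
  have h1 : ∑ i, ∑ n, |X i n| ^ p ≤ (N : ℝ) * d * c ^ p := by
    calc ∑ i, ∑ n, |X i n| ^ p ≤ ∑ _i : Fin d, ∑ _n : Fin N, c ^ p := by
          gcongr with i _ n _; exact h i n
      _ = (N : ℝ) * d * c ^ p := by
          simp only [Finset.sum_const, Finset.card_univ, Fintype.card_fin, nsmul_eq_mul]; ring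
  calc pNorm p X ≤ ((N : ℝ) * d * c ^ p) ^ (1 / p) :=
        Real.rpow_le_rpow (Finset.sum_nonneg fun _ _ => Finset.sum_nonneg fun _ _ =>
          Real.rpow_nonneg (abs_nonneg _) _) h1 (by positivity)
    _ = ((N : ℝ) * d) ^ (1 / p) * c := by
        rw [Real.mul_rpow (by positivity) (by positivity), ← Real.rpow_mul hc,
          mul_one_div_cancel hp.ne', Real.rpow_one]

theorem twoNorm_le_of_abs_le {X : Matrix (Fin d) (Fin N) ℝ} {c : ℝ} (hc : 0 ≤ c)
    (h : ∀ i n, |X i n| ≤ c) : twoNorm X ≤ c * Real.sqrt ((N : ℝ) * d) := by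
  have h1 : ∑ i, ∑ n, X i n ^ 2 ≤ c ^ 2 * ((N : ℝ) * d) := by
    calc ∑ i, ∑ n, X i n ^ 2 ≤ ∑ _i : Fin d, ∑ _n : Fin N, c ^ 2 :=
          Finset.sum_le_sum fun i _ => Finset.sum_le_sum fun n _ =>
            sq_le_sq.2 ((h i n).trans (le_abs_self c))
      _ = c ^ 2 * ((N : ℝ) * d) := by
          simp only [Finset.sum_const, Finset.card_univ, Fintype.card_fin, nsmul_eq_mul]; ring
  calc twoNorm X ≤ Real.sqrt (c ^ 2 * ((N : ℝ) * d)) := Real.sqrt_le_sqrt h1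
    _ = c * Real.sqrt ((N : ℝ) * d) := by rw [Real.sqrt_mul (sq_nonneg c), Real.sqrt_sq hc]

variable {f : Matrix (Fin d) (Fin N) ℝ → Matrix (Fin d) (Fin N) ℝ}

theorem modSeq_nonneg (δ : ℝ) : 0 ≤ modSeq p f δ :=
  Real.sSup_nonneg fun _ ⟨_, _, _, _, _, h⟩ => h ▸ pNorm_nonneg _

theorem vpNorm_nonneg (x : Fin d → ℝ) : 0 ≤ vpNorm p x :=
  Real.rpow_nonneg (Finset.sum_nonneg fun _ _ => Real.rpow_nonneg (abs_nonneg _) _) _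

theorem modCtx_nonneg (δ : ℝ) : 0 ≤ modCtx p f δ :=
  Real.sSup_nonneg fun _ ⟨_, _, _, _, _, _, _, h⟩ => h ▸ vpNorm_nonneg _

theorem modTok_nonneg (δ : ℝ) : 0 ≤ modTok p f δ :=
  Real.sSup_nonneg fun _ ⟨_, _, _, _, _, _, _, h⟩ => h ▸ vpNorm_nonneg _

theorem pNorm_sub_le_modSeq (hp : 0 < p) {M : ℝ} (hM0 : 0 ≤ M)
    (hM : ∀ X ∈ cube d N, ∀ i n, |f X i n| ≤ M) {δ : ℝ} {X Y : Matrix (Fin d) (Fin N) ℝ}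
    (hX : X ∈ cube d N) (hY : Y ∈ cube d N) (h : twoNorm (X - Y) ≤ δ) :
    pNorm p (f X - f Y) ≤ modSeq p f δ := by
  refine le_csSup ⟨((N : ℝ) * d) ^ (1 / p) * (2 * M), ?_⟩ ⟨X, hX, Y, hY, h, rfl⟩
  rintro _ ⟨X, hX, Y, hY, -, rfl⟩
  refine pNorm_le_of_abs_le hp (by linarith) fun i n => ?_
  rw [Matrix.sub_apply]
  exact (abs_sub _ _).trans (by linarith [hM X hX i n, hM Y hY i n])

end Norms

theorem twoNorm_gridPoint_sub_le {d N K : ℕ} (hK : 0 < K) {X : Matrix (Fin d) (Fin N) ℝ}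
    (hX : X ∈ cube d N) :
    twoNorm (gridPoint K (cellIndex K X) - X) ≤ 1 / K * Real.sqrt ((N : ℝ) * d) := by
  refine twoNorm_le_of_abs_le (by positivity) fun i n => ?_
  have hK' : (0 : ℝ) < K := by exact_mod_cast hK
  have h1 := Nat.floor_le (mul_nonneg hK'.le (hX i n).1)
  have h2 := Nat.lt_floor_add_one ((K : ℝ) * X i n)
  have h3 : (gridPoint K (cellIndex K X) - X) i n = ((cellIndex K X n i : ℝ) - K * X i n) / K := by
    rw [Matrix.sub_apply, gridPoint, Matrix.of_apply]
    field_simp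
  rw [h3, abs_div, abs_of_pos hK']
  refine div_le_div_of_nonneg_right ?_ hK'.le
  rw [abs_le, cellIndex]
  constructor <;> linarith

/-- The `L^p` error of the looped network for given discretization parameters. -/
theorem exists_lpNormOn_le {d N K L r : ℕ} {p M η ρ : ℝ} (hp : 1 ≤ p)
    {f : Matrix (Fin d) (Fin N) ℝ → Matrix (Fin d) (Fin N) ℝ}
    (hpe : PermEquivariant f) (hM : ∀ X ∈ cube d N, ∀ i n, |f X i n| ≤ M) (hM0 : 0 ≤ M)
    (hK : 0 < K) (hr : K + 1 + N + L * ((K + 1) ^ d + 1) ^ (N + 1) < r) (hη : 0 < η)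
    (hρ : 1 / K * Real.sqrt ((N : ℝ) * d) ≤ ρ) :
    ∃ (P : TFParams (17 * d + 9) 1 2 (49 * d + 25))
      (A1 : Matrix (Fin (17 * d + 9)) (Fin d) ℝ) (b1 : Fin (17 * d + 9) → ℝ)
      (A2 : Matrix (Fin d) (Fin (17 * d + 9)) ℝ) (b2 : Fin d → ℝ),
      LpNormOn p (fun X => loopedNet hardmaxCol P A1 b1 A2 b2 r X - f X) ≤
        modSeq p f ρ + ((N : ℝ) * d) ^ (1 / p) * ((2 * M + 1) * (1 / 2) ^ L) + η +
          ((N : ℝ) * d) ^ (1 / p) * (4 * M + 1) * ((N : ℝ) ^ 2 * (1 / K) ^ d) ^ (1 / p) := by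
  have hp0 : 0 < p := by linarith
  set S := ((N : ℝ) * d) ^ (1 / p) with hS
  have hS0 : 0 ≤ S := by positivity
  set c₁ := S * ((2 * M + 1) * r + 2 * M) with hc₁
  have hc₁0 : 0 ≤ c₁ := by positivity
  set A := 1 + d * N * ((K : ℝ) + 1) / (η / (c₁ + 1)) ^ p with hAdef
  have hηc : 0 < (η / (c₁ + 1)) ^ p := by positivity
  have hA : 1 ≤ A := le_add_of_nonneg_right (by positivity)
  obtain ⟨P, A1, b1, A2, b2, hnet⟩ := exists_loopedNet_approx hA hpe hM hM0 hr
  refine ⟨P, A1, b1, A2, b2, ?_⟩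
  have hprob := isProbabilityMeasure_restrict_cube d N
  have hdom : ∀ X ∈ cube d N,
      pNorm p (loopedNet hardmaxCol P A1 b1 A2 b2 r X - f X) ≤
        (modSeq p f ρ + S * ((2 * M + 1) * (1 / 2) ^ L)) +
          {X | ¬ Separated K A X}.indicator (fun _ => c₁) X +
          {X | ¬ Function.Injective (cellIndex K X)}.indicator (fun _ => S * (4 * M + 1)) X := by
    intro X hX
    have hω : 0 ≤ modSeq p f ρ := modSeq_nonneg ρ
    have hL : 0 ≤ S * ((2 * M + 1) * (1 / 2) ^ L) := by positivity
    have hc₂ : 0 ≤ {X : Matrix (Fin d) (Fin N) ℝ | ¬ Function.Injective (cellIndex K X)}.indicator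
        (fun _ => S * (4 * M + 1)) X := Set.indicator_nonneg (fun _ _ => by positivity) X
    by_cases hsep : Separated K A X
    · rw [Set.indicator_of_notMem (by simpa using hsep)]
      by_cases hinj : Function.Injective (cellIndex K X)
      · rw [Set.indicator_of_notMem (by simpa using hinj)]
        have hgrid : gridPoint K (cellIndex K X) ∈ cube d N :=
          gridPoint_mem_cube fun n i => cellIndex_le hX n i
        have h1 := pNorm_sub_le_modSeq hp0 hM0 hM hgrid hX
          ((twoNorm_gridPoint_sub_le hK hX).trans hρ)
        have h2 : pNorm p (loopedNet hardmaxCol P A1 b1 A2 b2 r X -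
            f (gridPoint K (cellIndex K X))) ≤ S * ((2 * M + 1) * (1 / 2) ^ L) :=
          pNorm_le_of_abs_le hp0 (by positivity) fun i n => (hnet X hX i n).2.2 hsep hinj
        have h3 := pNorm_add_le hp (loopedNet hardmaxCol P A1 b1 A2 b2 r X -
            f (gridPoint K (cellIndex K X))) (f (gridPoint K (cellIndex K X)) - f X)
        rw [sub_add_sub_cancel] at h3
        linarith
      · rw [Set.indicator_of_mem (by simpa using hinj)]
        have h1 : pNorm p (loopedNet hardmaxCol P A1 b1 A2 b2 r X - f X) ≤ S * (4 * M + 1) := by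
          refine pNorm_le_of_abs_le hp0 (by positivity) fun i n => ?_
          rw [Matrix.sub_apply]
          refine (abs_sub _ _).trans ?_
          linarith [(hnet X hX i n).2.1 hsep, hM X hX i n]
        linarith
    · rw [Set.indicator_of_mem (by simpa using hsep)]
      have h1 : pNorm p (loopedNet hardmaxCol P A1 b1 A2 b2 r X - f X) ≤ c₁ := by
        refine pNorm_le_of_abs_le hp0 (by positivity) fun i n => ?_
        rw [Matrix.sub_apply]
        refine (abs_sub _ _).trans ?_
        linarith [(hnet X hX i n).1, hM X hX i n]
      linarith
  have hmain := rpow_integral_rpow_le (μ := volume.restrict (cube d N)) hp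
    (u := fun X => pNorm p (loopedNet hardmaxCol P A1 b1 A2 b2 r X - f X))
    (fun X => pNorm_nonneg _)
    (add_nonneg (modSeq_nonneg ρ) (by positivity)) hc₁0
    (by positivity : 0 ≤ S * (4 * M + 1))
    (ae_restrict_of_forall_mem (measurableSet_cube d N) hdom)
  refine hmain.trans (add_le_add (add_le_add le_rfl ?_) ?_)
  · have h1 : (volume.restrict (cube d N)).real {X | ¬ Separated K A X} ≤ (η / (c₁ + 1)) ^ p := by
      refine (volume_not_separated_le hK (by linarith)).trans ?_
      rw [div_le_iff₀ (by linarith), hAdef]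
      field_simp
      linarith
    calc c₁ * (volume.restrict (cube d N)).real {X | ¬ Separated K A X} ^ (1 / p)
        ≤ c₁ * ((η / (c₁ + 1)) ^ p) ^ (1 / p) := by
          gcongr
      _ = c₁ / (c₁ + 1) * η := by
          rw [← Real.rpow_mul (by positivity), mul_one_div_cancel hp0.ne', Real.rpow_one]
          ring
      _ ≤ η := mul_le_of_le_one_left hη.le (div_le_one_of_le₀ (by linarith) (by linarith))
  · gcongr
    exact volume_cellIndex_not_injective_le hK

theorem isCompact_cube (d N : ℕ) : IsCompact (cube d N) := by
  rw [cube_eq_pi]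
  exact isCompact_univ_pi fun _ => isCompact_univ_pi fun _ => isCompact_Icc

theorem exists_abs_le_on_cube {d N : ℕ}
    {f : Matrix (Fin d) (Fin N) ℝ → Matrix (Fin d) (Fin N) ℝ} (hf : ContinuousOn f (cube d N)) :
    ∃ M, 0 ≤ M ∧ ∀ X ∈ cube d N, ∀ i n, |f X i n| ≤ M := by
  have hentry : ∀ i n, ∃ M, ∀ X ∈ cube d N, ‖f X i n‖ ≤ M := fun i n =>
    (isCompact_cube d N).exists_bound_of_continuousOn
      ((continuous_id.matrix_elem i n).comp_continuousOn hf)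
  choose M hM using hentry
  refine ⟨∑ i, ∑ n, |M i n|, by positivity, fun X hX i n => (hM i n X hX).trans ?_⟩
  calc M i n ≤ |M i n| := le_abs_self _
    _ ≤ ∑ n, |M i n| := Finset.single_le_sum (f := fun n => |M i n|) (fun _ _ => abs_nonneg _)
        (Finset.mem_univ n)
    _ ≤ ∑ i, ∑ n, |M i n| := Finset.single_le_sum (f := fun i => ∑ n, |M i n|)
        (fun _ _ => Finset.sum_nonneg fun _ _ => abs_nonneg _) (Finset.mem_univ i)

theorem exists_pow_mul_half_pow_le (d : ℕ) :
    ∃ C : ℝ, 0 < C ∧ ∀ n : ℕ, ((n : ℝ) + 1) ^ d * (1 / 2) ^ n ≤ C := by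
  obtain ⟨C, hC⟩ := (tendsto_pow_const_div_const_pow_of_one_lt d one_lt_two).bddAbove_range
  refine ⟨2 * |C| + 1, by positivity, fun n => ?_⟩
  have h := hC ⟨n + 1, rfl⟩
  have h1 : ((n : ℝ) + 1) ^ d * (1 / 2) ^ n = 2 * (((n + 1 : ℕ) : ℝ) ^ d / 2 ^ (n + 1)) := by
    rw [_root_.one_div_pow, pow_succ]
    push_cast
    field_simp
  rw [h1]
  linarith [le_abs_self C]

/-- Number of cells and number of bits affordable for a given budget. -/
theorem exists_cells_and_bits {d : ℕ} (N : ℕ) (hd : 0 < d) :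
    ∃ C : ℝ, 0 < C ∧ ∀ κ : ℝ, 3 ≤ κ → ∃ K L : ℕ, κ ≤ K ∧
      (K : ℝ) + 2 ≤ κ ^ ((N + 1) * d + 1) ∧
      (L : ℝ) * (((K : ℝ) + 1) ^ d + 1) ^ (N + 1) ≤ κ ^ ((N + 1) * d + 1) ∧
      (1 / 2) ^ L * κ ^ d ≤ C := by
  obtain ⟨C, hC0, hC⟩ := exists_pow_mul_half_pow_le d
  set c : ℝ := (2 * 3 ^ d) ^ (N + 1) with hc
  have hc0 : 0 < c := by positivity
  refine ⟨c ^ d * C, by positivity, fun κ hκ => ⟨⌈κ⌉₊, ⌊κ / c⌋₊, Nat.le_ceil κ, ?_, ?_, ?_⟩⟩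
  · have h1 := Nat.ceil_lt_add_one (by linarith : 0 ≤ κ)
    have h2 : κ ^ 2 ≤ κ ^ ((N + 1) * d + 1) := by
      refine pow_le_pow_right₀ (by linarith) ?_
      have : 1 ≤ (N + 1) * d := Nat.mul_pos (Nat.succ_pos N) hd
      omega
    nlinarith
  · have h1 := Nat.ceil_lt_add_one (by linarith : 0 ≤ κ)
    have h2 : ((⌈κ⌉₊ : ℝ) + 1) ^ d ≤ (3 * κ) ^ d := by gcongr; linarith
    have h3 : 1 ≤ (3 * κ) ^ d := one_le_pow₀ (by linarith)
    calc (⌊κ / c⌋₊ : ℝ) * (((⌈κ⌉₊ : ℝ) + 1) ^ d + 1) ^ (N + 1)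
        ≤ κ / c * (2 * (3 * κ) ^ d) ^ (N + 1) := by
          gcongr
          · exact Nat.floor_le (by positivity)
          · linarith
      _ = κ ^ ((N + 1) * d + 1) := by
          rw [mul_pow 3 κ d, ← mul_assoc, mul_pow, ← hc, ← pow_mul, mul_comm d, pow_succ]
          field_simp
  · have h1 : κ ≤ c * ((⌊κ / c⌋₊ : ℝ) + 1) := by
      have := Nat.lt_floor_add_one (κ / c)
      rw [div_lt_iff₀ hc0] at this
      linarith
    have h2 : κ ^ d ≤ c ^ d * ((⌊κ / c⌋₊ : ℝ) + 1) ^ d := by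
      rw [← mul_pow]; gcongr
    calc (1 / 2) ^ ⌊κ / c⌋₊ * κ ^ d
        ≤ (1 / 2) ^ ⌊κ / c⌋₊ * (c ^ d * ((⌊κ / c⌋₊ : ℝ) + 1) ^ d) := by gcongr
      _ = c ^ d * (((⌊κ / c⌋₊ : ℝ) + 1) ^ d * (1 / 2) ^ ⌊κ / c⌋₊) := by ring
      _ ≤ c ^ d * C := by gcongr; exact hC _

theorem loopDelta_pos {d N r : ℕ} (hr : N < r) : 0 < loopDelta d N r := by
  have : (N : ℝ) < r := by exact_mod_cast hr
  exact Real.rpow_pos_of_pos (by linarith) _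

theorem inv_loopDelta_pow {d N r : ℕ} (hr : N < r) :
    (loopDelta d N r)⁻¹ ^ ((N + 1) * d + 1) = ((r : ℝ) - N) / 2 := by
  have h : (N : ℝ) < r := by exact_mod_cast hr
  have hx : 0 < ((r : ℝ) - N) / 2 := by linarith
  rw [loopDelta, Real.rpow_neg hx.le, inv_inv, ← Real.rpow_natCast, ← Real.rpow_mul hx.le]
  push_cast
  rw [one_div_mul_cancel (by positivity), Real.rpow_one]

/-- The rate for sufficiently many loops. -/
theorem exists_rate_of_large {d N : ℕ} (hd : 0 < d) (hN : 0 < N) {p : ℝ} (hp : 1 ≤ p)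
    {f : Matrix (Fin d) (Fin N) ℝ → Matrix (Fin d) (Fin N) ℝ}
    (hf : ContinuousOn f (cube d N)) (hpe : PermEquivariant f) :
    ∃ C : ℝ, 0 < C ∧ ∀ r : ℕ, N + 2 * 3 ^ ((N + 1) * d + 1) ≤ r →
      ∃ (P : TFParams (17 * d + 9) 1 2 (49 * d + 25))
        (A1 : Matrix (Fin (17 * d + 9)) (Fin d) ℝ) (b1 : Fin (17 * d + 9) → ℝ)
        (A2 : Matrix (Fin d) (Fin (17 * d + 9)) ℝ) (b2 : Fin d → ℝ),
        LpNormOn p (fun X => loopedNet hardmaxCol P A1 b1 A2 b2 r X - f X) ≤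
          modSeq p f (loopDelta d N r * Real.sqrt ((N : ℝ) * (d : ℝ)))
            + C * ((N : ℝ) ^ (2 / p) * loopDelta d N r ^ ((d : ℝ) / p)) := by
  have hp0 : 0 < p := by linarith
  obtain ⟨M, hM0, hM⟩ := exists_abs_le_on_cube hf
  obtain ⟨C, hC0, hC⟩ := exists_cells_and_bits N hd
  set S := ((N : ℝ) * d) ^ (1 / p) with hS
  have hS0 : 0 ≤ S := by positivity
  refine ⟨S * (2 * M + 1) * C + 1 + S * (4 * M + 1), by positivity, fun r hr => ?_⟩
  have hNr : N < r := lt_of_lt_of_le (Nat.lt_add_of_pos_right (by positivity)) hr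
  set δ := loopDelta d N r with hδ
  have hδ0 : 0 < δ := loopDelta_pos hNr
  have hpow : δ⁻¹ ^ ((N + 1) * d + 1) = ((r : ℝ) - N) / 2 := inv_loopDelta_pow hNr
  have hδ3 : 3 ≤ δ⁻¹ := by
    refine le_of_pow_le_pow_left₀ (n := (N + 1) * d + 1) (by omega) (by positivity) ?_
    rw [hpow]
    have : (N : ℝ) + 2 * 3 ^ ((N + 1) * d + 1) ≤ r := by exact_mod_cast hr
    linarith
  have hδ1 : δ ≤ 1 := by
    rw [← one_div, le_div_iff₀ hδ0] at hδ3
    linarith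
  obtain ⟨K, L, hK, hK2, hL, hLC⟩ := hC δ⁻¹ hδ3
  have hK0 : (0 : ℝ) < K := by linarith
  have hKδ : 1 / (K : ℝ) ≤ δ := by
    rw [one_div]
    exact inv_le_of_inv_le₀ hδ0 hK
  have hbudget : K + 1 + N + L * ((K + 1) ^ d + 1) ^ (N + 1) < r := by
    have : (K : ℝ) + 1 + N + L * (((K : ℝ) + 1) ^ d + 1) ^ (N + 1) < r := by
      rw [hpow] at hK2 hL
      linarith
    exact_mod_cast this
  obtain ⟨P, A1, b1, A2, b2, h⟩ := exists_lpNormOn_le (η := δ ^ ((d : ℝ) / p)) hp hpe hM hM0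
    (by exact_mod_cast hK0) hbudget (by positivity)
    (mul_le_mul_of_nonneg_right hKδ (Real.sqrt_nonneg ((N : ℝ) * d)))
  refine ⟨P, A1, b1, A2, b2, h.trans ?_⟩
  have hN1 : 1 ≤ (N : ℝ) ^ (2 / p) :=
    Real.one_le_rpow (by exact_mod_cast hN) (by positivity)
  have hw : δ ^ ((d : ℝ) / p) ≤ (N : ℝ) ^ (2 / p) * δ ^ ((d : ℝ) / p) :=
    le_mul_of_one_le_left (by positivity) hN1
  have hdp : δ ^ d ≤ δ ^ ((d : ℝ) / p) := by
    rw [← Real.rpow_natCast]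
    exact Real.rpow_le_rpow_of_exponent_ge hδ0 hδ1 (div_le_self (by positivity) hp)
  have hbits : (1 / 2 : ℝ) ^ L ≤ C * ((N : ℝ) ^ (2 / p) * δ ^ ((d : ℝ) / p)) := by
    calc (1 / 2 : ℝ) ^ L = (1 / 2) ^ L * δ⁻¹ ^ d * δ ^ d := by
          rw [mul_assoc, ← mul_pow, inv_mul_cancel₀ hδ0.ne', one_pow, mul_one]
      _ ≤ C * ((N : ℝ) ^ (2 / p) * δ ^ ((d : ℝ) / p)) :=
          mul_le_mul hLC (hdp.trans hw) (by positivity) hC0.le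
  have hcell : ((N : ℝ) ^ 2 * (1 / K) ^ d) ^ (1 / p) ≤
      (N : ℝ) ^ (2 / p) * δ ^ ((d : ℝ) / p) := by
    calc ((N : ℝ) ^ 2 * (1 / K) ^ d) ^ (1 / p) ≤ ((N : ℝ) ^ 2 * δ ^ d) ^ (1 / p) := by gcongr
      _ = (N : ℝ) ^ (2 / p) * δ ^ ((d : ℝ) / p) := by
          rw [Real.mul_rpow (by positivity) (by positivity), ← Real.rpow_natCast,
            ← Real.rpow_natCast, ← Real.rpow_mul (by positivity), ← Real.rpow_mul hδ0.le,
            mul_one_div, mul_one_div, Nat.cast_ofNat]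
  generalize (N : ℝ) ^ (2 / p) * δ ^ ((d : ℝ) / p) = w at *
  have h1 : S * ((2 * M + 1) * (1 / 2) ^ L) ≤ S * ((2 * M + 1) * (C * w)) := by gcongr
  have h2 : S * (4 * M + 1) * ((N : ℝ) ^ 2 * (1 / K) ^ d) ^ (1 / p) ≤ S * (4 * M + 1) * w := by
    gcongr
  linarith

theorem lpNormOn_eq_zero_of_isEmpty {d N : ℕ} {p : ℝ} (hp : 0 < p) (h : d = 0 ∨ N = 0)
    (g : Matrix (Fin d) (Fin N) ℝ → Matrix (Fin d) (Fin N) ℝ) : LpNormOn p g = 0 := by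
  have h0 : ∀ X : Matrix (Fin d) (Fin N) ℝ, pNorm p X = 0 := fun X => by
    rcases h with rfl | rfl <;> simp [pNorm, hp.ne']
  simp [LpNormOn, h0, hp.ne']

/-- Theorem A.1, hardmax / unbounded weights: approximation rate
of Looped Transformers with hardmax attention.  For every continuous
permutation-equivariant `f : [0,1]^{d×N} → ℝ^{d×N}` there is a constant
`C > 0` independent of `r` such that for every `r > N` there exist a hardmax
Transformer block on `ℝ^{(17d+9)×N}` with two heads, head size 1, width
`49d+25`, and token-wise affine maps `L₁, L₂`, with
`‖L₂∘TF^{∘r}∘L₁ − f‖_{L^p} ≤ (Nd)^{1/p}(ω^tok_f(δ√d) + ω^cont_f(δ√(Nd)))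
  + ω_f(δ√(Nd)) + C·N^{2/p}·δ^{d/p}`, where `δ = ((r−N)/2)^{−1/((N+1)d+1)}`. -/
theorem looped_transformer_rate_hardmax (d N : ℕ) (p : ℝ) (hp : 1 ≤ p)
    (f : Matrix (Fin d) (Fin N) ℝ → Matrix (Fin d) (Fin N) ℝ)
    (hf : ContinuousOn f (cube d N)) (hpe : PermEquivariant f) :
    ∃ C : ℝ, 0 < C ∧
      ∀ r : ℕ, N < r →
        ∃ (P : TFParams (17 * d + 9) 1 2 (49 * d + 25))
          (A1 : Matrix (Fin (17 * d + 9)) (Fin d) ℝ) (b1 : Fin (17 * d + 9) → ℝ)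
          (A2 : Matrix (Fin d) (Fin (17 * d + 9)) ℝ) (b2 : Fin d → ℝ),
          LpNormOn p (fun X => loopedNet hardmaxCol P A1 b1 A2 b2 r X - f X) ≤
            ((N : ℝ) * (d : ℝ)) ^ (1 / p) *
                (modTok p f (loopDelta d N r * Real.sqrt (d : ℝ)) +
                 modCtx p f (loopDelta d N r * Real.sqrt ((N : ℝ) * (d : ℝ))))
              + modSeq p f (loopDelta d N r * Real.sqrt ((N : ℝ) * (d : ℝ)))
              + C * (N : ℝ) ^ (2 / p) * loopDelta d N r ^ ((d : ℝ) / p) := by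
  have hp0 : 0 < p := by linarith
  have hmod : ∀ r, 0 ≤ ((N : ℝ) * (d : ℝ)) ^ (1 / p) *
      (modTok p f (loopDelta d N r * Real.sqrt (d : ℝ)) +
        modCtx p f (loopDelta d N r * Real.sqrt ((N : ℝ) * (d : ℝ)))) := fun r =>
    mul_nonneg (by positivity) (add_nonneg (modTok_nonneg _) (modCtx_nonneg _))
  let P₀ : TFParams (17 * d + 9) 1 2 (49 * d + 25) := ⟨⟨0, 0, 0, 0⟩, ⟨0, 0, 0, 0⟩⟩
  by_cases hdN : d = 0 ∨ N = 0
  · refine ⟨1, one_pos, fun r hr => ⟨P₀, 0, 0, 0, 0, ?_⟩⟩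
    rw [lpNormOn_eq_zero_of_isEmpty hp0 hdN]
    have h1 := hmod r
    have h2 := modSeq_nonneg (p := p) (f := f) (loopDelta d N r * Real.sqrt ((N : ℝ) * (d : ℝ)))
    have h3 := loopDelta_pos (d := d) hr
    positivity
  · have hd : 0 < d := by omega
    have hN : 0 < N := by omega
    obtain ⟨C, hC0, hC⟩ := exists_rate_of_large hd hN hp hf hpe
    set r₀ := N + 2 * 3 ^ ((N + 1) * d + 1) with hr₀
    set E : ℕ → ℝ := fun r =>
      LpNormOn p (fun X => loopedNet hardmaxCol P₀ 0 0 0 0 r X - f X) with hE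
    set w : ℕ → ℝ := fun r => (N : ℝ) ^ (2 / p) * loopDelta d N r ^ ((d : ℝ) / p) with hw
    have hw0 : ∀ r, N < r → 0 < w r := fun r hr => by
      have := loopDelta_pos (d := d) hr
      positivity
    set C' := ∑ r ∈ Finset.range r₀, |E r / w r| with hC'
    have hC'0 : 0 ≤ C' := Finset.sum_nonneg fun _ _ => abs_nonneg _
    refine ⟨C + C', by linarith, fun r hr => ?_⟩
    rw [mul_assoc]
    have h1 := hmod r
    have h2 := modSeq_nonneg (p := p) (f := f) (loopDelta d N r * Real.sqrt ((N : ℝ) * (d : ℝ)))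
    by_cases hlarge : r₀ ≤ r
    · obtain ⟨P, A1, b1, A2, b2, h⟩ := hC r hlarge
      refine ⟨P, A1, b1, A2, b2, h.trans ?_⟩
      have h3 : C * w r ≤ (C + C') * w r :=
        mul_le_mul_of_nonneg_right (by linarith) (hw0 r hr).le
      simp only [hw] at h3
      linarith
    · refine ⟨P₀, 0, 0, 0, 0, ?_⟩
      have h3 : |E r / w r| ≤ C' := Finset.single_le_sum (f := fun r => |E r / w r|)
        (fun _ _ => abs_nonneg _) (Finset.mem_range.2 (not_le.1 hlarge))
      have h4 : E r ≤ (C + C') * w r := by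
        rw [← div_le_iff₀ (hw0 r hr)]
        linarith [le_abs_self (E r / w r)]
      simp only [hw, hE] at h4
      linarith
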